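/- Let Γ be a countably infinite group, let k ≥ 2 be an integer, let S be a subshift of finite type (inside m^Γ for some m ≥ 1), and let π : Free(k^Γ) → S be a continuous Γ-equivariant map. Then there exists a subshift S' ⊆ S such that: (1) the stabilizer of every point of S' equals Stab(π); and (2) every free Borel action of Γ on a Polish space X admits a Borel Γ-equivariant map X → S'. -/

import Mathlib

open scoped Pointwise
section ShiftDefs

variable {Γ : Type} [Group Γ] {A B : Type*}

/-- The Bernoulli shift action of `Γ`: `(γ · x)(δ) = x(δγ)`. -/
def shiftAct (γ : Γ) (x : Γ → A) : Γ → A := fun δ => x (δ * γ)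

/-- The free part of the shift `Γ ↷ (Γ → A)`. -/
def freePart (Γ : Type) [Group Γ] (A : Type*) : Set (Γ → A) :=
  {x | ∀ γ : Γ, shiftAct γ x = x → γ = 1}

/-- A subshift: a closed shift-invariant subset. -/
def IsSubshift [TopologicalSpace A] (S : Set (Γ → A)) : Prop :=
  IsClosed S ∧ ∀ γ : Γ, ∀ x ∈ S, shiftAct γ x ∈ S

/-- A subshift of finite type: `⋂ γ (γ · C)` for some clopen `C`. -/
def IsSFT [TopologicalSpace A] (S : Set (Γ → A)) : Prop :=
  ∃ C : Set (Γ → A), IsClopen C ∧ S = ⋂ γ : Γ, shiftAct γ ⁻¹' C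

/-- The stabilizer of a point under the shift action. -/
def ptStab (x : Γ → A) : Set Γ := {γ | shiftAct γ x = x}

/-- `Stab(π)`: elements fixing every point in the image of `π` (domain `dom`). -/
def mapStab (π : (Γ → A) → (Γ → B)) (dom : Set (Γ → A)) : Set Γ :=
  {γ | ∀ x ∈ dom, shiftAct γ (π x) = π x}

/-- `Γ`-equivariance of `π` on the set `dom`. -/
def EquivariantOn (π : (Γ → A) → (Γ → B)) (dom : Set (Γ → A)) : Prop :=
  ∀ x ∈ dom, ∀ γ : Γ, π (shiftAct γ x) = shiftAct γ (π x)

/-- `Col(F, ℓ)`: proper `ℓ`-colorings of the Cayley graph `G(Γ, F)`. -/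
def properCol (F : Finset Γ) (ℓ : ℕ) : Set (Γ → Fin ℓ) :=
  {x | ∀ γ : Γ, ∀ σ ∈ F, x γ ≠ x (σ * γ)}

end ShiftDefs

section GroupCombinatorics

variable {Γ : Type} [Group Γ]

/-- The conjugacy class of `g` is finite. -/
def HasFiniteClass (g : Γ) : Prop := (Set.range fun h : Γ => h * g * h⁻¹).Finite

/-- The elements with finite conjugacy class that are conjugate to an element of `F`. -/
def exceptional (F : Finset Γ) : Set Γ := {g | HasFiniteClass g ∧ ∃ h : Γ, h * g * h⁻¹ ∈ F}

lemma range_conj_conj (a g : Γ) :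
    (Set.range fun h : Γ => h * (a * g * a⁻¹) * h⁻¹) = Set.range fun h : Γ => h * g * h⁻¹ := by
  ext x
  constructor
  · rintro ⟨h, rfl⟩
    exact ⟨h * a, by group⟩
  · rintro ⟨h, rfl⟩
    exact ⟨h * a⁻¹, by group⟩

lemma hasFiniteClass_conj {a g : Γ} : HasFiniteClass (a * g * a⁻¹) ↔ HasFiniteClass g := by
  unfold HasFiniteClass
  rw [range_conj_conj]

lemma exceptional_conj {F : Finset Γ} {g : Γ} (hg : g ∈ exceptional F) (a : Γ) :
    a * g * a⁻¹ ∈ exceptional F := by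
  obtain ⟨h1, h, h2⟩ := hg
  exact ⟨hasFiniteClass_conj.2 h1, h * a⁻¹, by convert h2 using 1; group⟩

lemma exceptional_finite (F : Finset Γ) : (exceptional F).Finite := by
  have : exceptional F ⊆ ⋃ f ∈ {f ∈ (F : Set Γ) | HasFiniteClass f},
      Set.range fun h : Γ => h * f * h⁻¹ := by
    rintro g ⟨h1, h, h2⟩
    simp only [Set.mem_iUnion]
    exact ⟨h * g * h⁻¹, ⟨h2, hasFiniteClass_conj.2 h1⟩, h⁻¹, by group⟩
  refine Set.Finite.subset (Set.Finite.biUnion (F.finite_toSet.subset fun x hx => hx.1) ?_) this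
  exact fun f hf => hf.2

lemma hasFiniteClass_of_finiteIndex {g : Γ} (h : (Subgroup.centralizer {g}).FiniteIndex) :
    HasFiniteClass g := by
  have : Finite (Γ ⧸ Subgroup.centralizer {g}) := Subgroup.finite_quotient_of_finiteIndex
  refine (Set.finite_range (fun q : Γ ⧸ Subgroup.centralizer {g} =>
    q.out * g * q.out⁻¹)).subset ?_
  rintro _ ⟨h, rfl⟩
  refine ⟨(h : Γ ⧸ Subgroup.centralizer {g}), ?_⟩
  beta_reduce
  have h1 : h⁻¹ * (h : Γ ⧸ Subgroup.centralizer {g}).out ∈ Subgroup.centralizer {g} := by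
    rw [← QuotientGroup.eq]
    simp
  rw [Subgroup.mem_centralizer_singleton_iff] at h1
  generalize (h : Γ ⧸ Subgroup.centralizer {g}).out = k at h1 ⊢
  have : k * g = h * g * h⁻¹ * k := by
    calc k * g = h * (h⁻¹ * k * g) := by group
      _ = h * (g * (h⁻¹ * k)) := by rw [h1]
      _ = _ := by group
  rw [this]
  group

/-- An infinite group is not covered by finitely many points together with finitely many
sets of elements conjugating a given element with infinite class to another one. -/
lemma exists_avoiding [Infinite Γ] (E : Finset Γ) (H K : Finset Γ) :
    ∃ a ∉ E, ∀ h ∈ H, ∀ e ∈ K, ¬ HasFiniteClass h → a⁻¹ * h * a ≠ e := by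
  classical
  by_contra! hcon
  let g : Γ × Γ → Γ := fun p =>
    if hp : ∃ a : Γ, a⁻¹ * p.1 * a = p.2 then hp.choose else 1
  let s : Finset (Γ × Subgroup Γ) := (E.image fun e => (e, ⊥)) ∪
    (((H ×ˢ K).filter fun p => ¬ HasFiniteClass p.2).image
      fun p => (g p, Subgroup.centralizer {p.2}))
  have hcov : ⋃ i ∈ s, i.1 • (i.2 : Set Γ) = Set.univ := by
    refine Set.eq_univ_of_forall fun a => ?_
    simp only [Set.mem_iUnion]
    by_cases ha : a ∈ E
    · refine ⟨(a, ⊥), Finset.mem_union_left _ (Finset.mem_image_of_mem _ ha), ?_⟩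
      exact ⟨1, by simp, by simp⟩
    · obtain ⟨h, hh, e, he, hfc, hae⟩ := hcon a ha
      have hex : ∃ a : Γ, a⁻¹ * (h, e).1 * a = (h, e).2 := ⟨a, hae⟩
      have hg : (g (h, e))⁻¹ * h * g (h, e) = e := by
        simp only [g, dif_pos hex]
        exact hex.choose_spec
      refine ⟨(g (h, e), Subgroup.centralizer {e}), Finset.mem_union_right _
        (Finset.mem_image.2 ⟨(h, e), ?_, rfl⟩), ?_⟩
      · simp only [Finset.mem_filter, Finset.mem_product]
        refine ⟨⟨hh, he⟩, fun hf => hfc ?_⟩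
        rw [← hae] at hf
        have := (hasFiniteClass_conj (a := a⁻¹) (g := h)).1 (by simpa using hf)
        exact this
      · refine ⟨(g (h, e))⁻¹ * a, ?_, by simp⟩
        simp only [SetLike.mem_coe]
        rw [Subgroup.mem_centralizer_singleton_iff]
        generalize g (h, e) = b at hg
        have h1 : h * a = a * e := by rw [← hae]; group
        have h2 : b⁻¹ * h = e * b⁻¹ := by rw [← hg]; group
        calc b⁻¹ * a * e = b⁻¹ * (h * a) := by rw [h1]; group
          _ = b⁻¹ * h * a := by group
          _ = _ := by rw [h2]; group
  obtain ⟨k, hk, hfin⟩ := Subgroup.exists_finiteIndex_of_leftCoset_cover hcov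
  rcases Finset.mem_union.1 hk with hk | hk
  · obtain ⟨e, -, rfl⟩ := Finset.mem_image.1 hk
    have := hfin
    have h2 : Finite (Γ ⧸ (⊥ : Subgroup Γ)) := Subgroup.finite_quotient_of_finiteIndex
    have : Finite Γ := Finite.of_equiv _ QuotientGroup.quotientBot.toEquiv
    exact not_finite Γ
  · obtain ⟨p, hp, rfl⟩ := Finset.mem_image.1 hk
    exact (Finset.mem_filter.1 hp).2 (hasFiniteClass_of_finiteIndex hfin)

/-- There are arbitrarily large sets `A` of translates making the translates `B * a` pairwise
disjoint, such that few elements of `B * A` conjugate a given element with infinite class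
into `F`. -/
lemma exists_spread [Infinite Γ] [DecidableEq Γ] (F B : Finset Γ) (t : ℕ) :
    ∃ A : Finset Γ, A.card = t ∧ (B * A).card = B.card * t ∧
      ∀ θ : Γ, ¬ HasFiniteClass θ →
        ((B * A).filter fun c => c * θ * c⁻¹ ∈ F).card ≤ B.card := by
  let H : Finset Γ := (B ×ˢ F).image fun p => p.1⁻¹ * p.2 * p.1
  have key : ∀ t : ℕ, ∃ A : Finset Γ, A.card = t ∧
      (∀ a ∈ A, ∀ a' ∈ A, ∀ b ∈ B, ∀ b' ∈ B, b * a = b' * a' → a = a') ∧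
      ∀ θ : Γ, ¬ HasFiniteClass θ → ∀ a ∈ A, ∀ a' ∈ A, a * θ * a⁻¹ ∈ H → a' * θ * a'⁻¹ ∈ H →
        a = a' := by
    intro t
    induction t with
    | zero => exact ⟨∅, by simp⟩
    | succ t ih =>
      obtain ⟨A, hA, h1, h2⟩ := ih
      obtain ⟨a, haE, haK⟩ := exists_avoiding (A ∪ B⁻¹ * B * A) H
        ((A ×ˢ H).image fun p => p.1⁻¹ * p.2 * p.1)
      rw [Finset.mem_union, not_or] at haE
      have h3 : ∀ a' ∈ A, ∀ b ∈ B, ∀ b' ∈ B, b * a ≠ b' * a' := by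
        intro a' ha' b hb b' hb' h
        apply haE.2
        have : a = b⁻¹ * b' * a' := by rw [mul_assoc, ← h]; group
        rw [this]
        exact Finset.mul_mem_mul (Finset.mul_mem_mul (Finset.inv_mem_inv hb) hb') ha'
      have h4 : ∀ θ : Γ, ¬ HasFiniteClass θ → ∀ a' ∈ A, a * θ * a⁻¹ ∈ H → a' * θ * a'⁻¹ ∈ H →
          False := by
        intro θ hθ a' ha' haH ha'H
        refine haK _ haH θ (Finset.mem_image.2 ⟨(a', a' * θ * a'⁻¹), ?_, ?_⟩) ?_ ?_
        · exact Finset.mem_product.2 ⟨ha', ha'H⟩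
        · group
        · rwa [hasFiniteClass_conj]
        · group
      refine ⟨insert a A, by rw [Finset.card_insert_of_notMem haE.1, hA], ?_, ?_⟩
      · intro x hx y hy b hb b' hb' h
        rcases Finset.mem_insert.1 hx with hxa | hxA <;>
          rcases Finset.mem_insert.1 hy with hya | hyA
        · rw [hxa, hya]
        · exact absurd (hxa ▸ h) (h3 y hyA b hb b' hb')
        · exact absurd (hya ▸ h).symm (h3 x hxA b' hb' b hb)
        · exact h1 x hxA y hyA b hb b' hb' h
      · intro θ hθ x hx y hy hxH hyH
        rcases Finset.mem_insert.1 hx with hxa | hxA <;>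
          rcases Finset.mem_insert.1 hy with hya | hyA
        · rw [hxa, hya]
        · exact (h4 θ hθ y hyA (hxa ▸ hxH) hyH).elim
        · exact (h4 θ hθ x hxA (hya ▸ hyH) hxH).elim
        · exact h2 θ hθ x hxA y hyA hxH hyH
  obtain ⟨A, hA, h1, h2⟩ := key t
  refine ⟨A, hA, ?_, ?_⟩
  · rw [← hA, Finset.card_mul_iff]
    rintro ⟨b, a⟩ hba ⟨b', a'⟩ hba' h
    simp only [Set.mem_prod, Finset.mem_coe] at hba hba' h
    have := h1 a hba.2 a' hba'.2 b hba.1 b' hba'.1 h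
    subst this
    rw [mul_right_cancel h]
  · intro θ hθ
    have hH : ∀ b ∈ B, ∀ a : Γ, b * a * θ * (b * a)⁻¹ ∈ F → a * θ * a⁻¹ ∈ H := by
      intro b hb a h
      exact Finset.mem_image.2 ⟨(b, _), Finset.mem_product.2 ⟨hb, h⟩, by group⟩
    rcases ((B * A).filter fun c => c * θ * c⁻¹ ∈ F).eq_empty_or_nonempty with h0 | ⟨c, hc⟩
    · simp [h0]
    obtain ⟨hc1, hc2⟩ := Finset.mem_filter.1 hc
    obtain ⟨b₀, hb₀, a₀, ha₀, rfl⟩ := Finset.mem_mul.1 hc1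
    refine (Finset.card_le_card (t := B.image (· * a₀)) ?_).trans Finset.card_image_le
    intro d hd
    obtain ⟨hd1, hd2⟩ := Finset.mem_filter.1 hd
    obtain ⟨b, hb, a, ha, rfl⟩ := Finset.mem_mul.1 hd1
    have := h2 θ hθ a ha a₀ ha₀ (hH b hb a hd2) (hH b₀ hb₀ a₀ hc2)
    subst this
    exact Finset.mem_image_of_mem _ hb

/-- A finite family of large subsets of `C` admits a small hitting set whose elements are
pairwise apart with respect to `F`. -/
lemma exists_hitting [DecidableEq Γ] {ι : Type} (F C : Finset Γ) (hFinv : F⁻¹ = F)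
    (I : Finset ι) (G : ι → Finset Γ) (N : ℝ) (r h : ℕ) (hN : 0 < N)
    (hG : ∀ i ∈ I, G i ⊆ C) (hGN : ∀ i ∈ I, N ≤ (G i).card)
    (hr : 2 * (C.card : ℝ) ≤ r * N) (hFN : 2 * (F.card : ℝ) * (r * h : ℕ) ≤ N)
    (hh : h ≠ 0) (hI : I.card ≤ 2 ^ h) :
    ∃ K ⊆ C, K.card ≤ r * h ∧ (∀ k ∈ K, ∀ f ∈ F, f * k ∈ K → f = 1) ∧
      (∀ i ∈ I, ∃ k ∈ K, k ∈ G i) ∧ ∀ k ∈ K, ∃ i ∈ I, k ∈ G i := by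
  classical
  rcases I.eq_empty_or_nonempty with rfl | ⟨i₀, hi₀⟩
  · exact ⟨∅, by simp⟩
  have hCpos : 0 < (C.card : ℝ) :=
    hN.trans_le ((hGN i₀ hi₀).trans (by exact_mod_cast Finset.card_le_card (hG i₀ hi₀)))
  have hrpos : 0 < (r : ℝ) := by
    by_contra hcon
    have : (r : ℝ) = 0 := le_antisymm (not_lt.1 hcon) (Nat.cast_nonneg _)
    rw [this] at hr
    linarith
  have hr1 : (1 : ℝ) ≤ r := by
    have : 0 < r := by exact_mod_cast hrpos
    exact_mod_cast this
  have key : ∀ j ≤ r * h, ∃ K ⊆ C, K.card ≤ j ∧ (∀ k ∈ K, ∀ f ∈ F, f * k ∈ K → f = 1) ∧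
      (∀ k ∈ K, ∃ i ∈ I, k ∈ G i) ∧
      ((I.filter fun i => Disjoint K (G i)).card : ℝ) ≤ I.card * (1 - 1 / r) ^ j := by
    intro j
    induction j with
    | zero =>
      intro _
      exact ⟨∅, by simp⟩
    | succ j ih =>
      intro hj
      obtain ⟨K, hKC, hKj, hsep, hKG, hcard⟩ := ih (by omega)
      set J := I.filter fun i => Disjoint K (G i) with hJ
      have hq : (0 : ℝ) ≤ 1 - 1 / r := by
        rw [sub_nonneg, div_le_one hrpos]; exact hr1
      rcases J.eq_empty_or_nonempty with hJ0 | ⟨i₁, hi₁⟩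
      · refine ⟨K, hKC, by omega, hsep, hKG, ?_⟩
        rw [← hJ, hJ0]
        simp only [Finset.card_empty, Nat.cast_zero]
        positivity
      have hFK : ∀ i ∈ J, N / 2 ≤ ((G i \ (F * K)).card : ℝ) := by
        intro i hi
        have h1 : (G i).card ≤ (G i \ (F * K)).card + (F * K).card := by
          rw [← Nat.sub_le_iff_le_add]
          exact Finset.le_card_sdiff _ _
        have h2 : (F * K).card ≤ F.card * (r * h) :=
          Finset.card_mul_le.trans (Nat.mul_le_mul_left _ (by omega))
        have h3 := hGN i (Finset.mem_filter.1 hi).1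
        have h1' : ((G i).card : ℝ) ≤ (G i \ (F * K)).card + (F * K).card := by exact_mod_cast h1
        have h2' : ((F * K).card : ℝ) ≤ F.card * (r * h : ℕ) := by exact_mod_cast h2
        linarith
      have hsum : (J.card : ℝ) * (N / 2) ≤
          ∑ c ∈ C, ((J.filter fun i => c ∈ G i \ (F * K)).card : ℝ) := by
        calc (J.card : ℝ) * (N / 2) = ∑ i ∈ J, N / 2 := by simp
          _ ≤ ∑ i ∈ J, ((G i \ (F * K)).card : ℝ) := Finset.sum_le_sum hFK
          _ = ∑ i ∈ J, ((C.filter fun c => c ∈ G i \ (F * K)).card : ℝ) := by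
            refine Finset.sum_congr rfl fun i hi => ?_
            congr 2
            ext c
            simp only [Finset.mem_filter]
            refine ⟨fun hc => ⟨hG i (Finset.mem_filter.1 hi).1 (Finset.mem_sdiff.1 hc).1, hc⟩,
              fun hc => hc.2⟩
          _ = _ := by
            have := Finset.sum_card_bipartiteAbove_eq_sum_card_bipartiteBelow
              (s := J) (t := C) (fun i c => c ∈ G i \ (F * K))
            simp only [Finset.bipartiteAbove, Finset.bipartiteBelow] at this
            exact_mod_cast this
      obtain ⟨c, hcC, hc⟩ : ∃ c ∈ C, (J.card : ℝ) / r ≤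
          ((J.filter fun i => c ∈ G i \ (F * K)).card : ℝ) := by
        by_contra! hcon
        have hCne : C.Nonempty := Finset.card_pos.1 (by exact_mod_cast hCpos)
        have h1 := Finset.sum_lt_sum_of_nonempty hCne hcon
        simp only [Finset.sum_const, nsmul_eq_mul] at h1
        have h2 : (C.card : ℝ) * (J.card / r) ≤ J.card * (N / 2) := by
          rw [← mul_div_assoc, div_le_iff₀ hrpos]
          have : (0 : ℝ) ≤ J.card := Nat.cast_nonneg _
          nlinarith
        linarith
      have hJpos : 0 < (J.card : ℝ) := by exact_mod_cast Finset.card_pos.2 ⟨i₁, hi₁⟩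
      obtain ⟨i₂, hi₂⟩ : (J.filter fun i => c ∈ G i \ (F * K)).Nonempty := by
        rw [← Finset.card_pos]
        have : (0 : ℝ) < ((J.filter fun i => c ∈ G i \ (F * K)).card : ℝ) :=
          lt_of_lt_of_le (by positivity) hc
        exact_mod_cast this
      obtain ⟨hi₂J, hi₂c⟩ := Finset.mem_filter.1 hi₂
      obtain ⟨hcG, hcFK⟩ := Finset.mem_sdiff.1 hi₂c
      refine ⟨insert c K, Finset.insert_subset hcC hKC,
        (Finset.card_insert_le _ _).trans (by omega), ?_, ?_, ?_⟩
      · intro k hk f hf hfk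
        rcases Finset.mem_insert.1 hk with rfl | hk <;> rcases Finset.mem_insert.1 hfk with h | h
        · simpa using h
        · exfalso
          apply hcFK
          rw [show k = f⁻¹ * (f * k) by group]
          exact Finset.mul_mem_mul (by rw [← hFinv]; exact Finset.inv_mem_inv hf) h
        · exfalso
          apply hcFK
          rw [← h]
          exact Finset.mul_mem_mul hf hk
        · exact hsep k hk f hf h
      · intro k hk
        rcases Finset.mem_insert.1 hk with rfl | hk
        · exact ⟨i₂, (Finset.mem_filter.1 hi₂J).1, hcG⟩
        · exact hKG k hk
      · have hsub : (I.filter fun i => Disjoint (insert c K) (G i)) ⊆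
            J \ (J.filter fun i => c ∈ G i \ (F * K)) := by
          intro i hi
          obtain ⟨hiI, hid⟩ := Finset.mem_filter.1 hi
          rw [Finset.disjoint_insert_left] at hid
          refine Finset.mem_sdiff.2 ⟨Finset.mem_filter.2 ⟨hiI, hid.2⟩, fun h => ?_⟩
          exact hid.1 (Finset.mem_sdiff.1 (Finset.mem_filter.1 h).2).1
        have h1 := Finset.card_le_card hsub
        rw [Finset.card_sdiff_of_subset (Finset.filter_subset _ _)] at h1
        have h2 : ((I.filter fun i => Disjoint (insert c K) (G i)).card : ℝ) ≤
            J.card - (J.filter fun i => c ∈ G i \ (F * K)).card := by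
          rw [← Nat.cast_sub (Finset.card_filter_le _ _)]
          exact_mod_cast h1
        calc _ ≤ (J.card : ℝ) - J.card / r := by linarith
          _ = J.card * (1 - 1 / r) := by ring
          _ ≤ I.card * (1 - 1 / r) ^ j * (1 - 1 / r) := mul_le_mul_of_nonneg_right hcard hq
          _ = _ := by ring
  obtain ⟨K, hKC, hKj, hsep, hKG, hcard⟩ := key (r * h) le_rfl
  refine ⟨K, hKC, hKj, hsep, ?_, hKG⟩
  have hlt : (I.card : ℝ) * (1 - 1 / r) ^ (r * h) < 1 := by
    have h1 : (1 - 1 / (r : ℝ)) ^ r ≤ Real.exp (-1) := Real.one_sub_div_pow_le_exp_neg hr1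
    have h2 : ((1 - 1 / (r : ℝ)) ^ r) ^ h ≤ Real.exp (-1) ^ h := by
      apply pow_le_pow_left₀ _ h1
      apply pow_nonneg
      rw [sub_nonneg, div_le_one hrpos]; exact hr1
    have h3 : (I.card : ℝ) ≤ 2 ^ h := by exact_mod_cast hI
    have h4 : 2 * Real.exp (-1) < 1 := by
      rw [Real.exp_neg, ← div_eq_mul_inv, div_lt_one (Real.exp_pos _)]
      have := Real.exp_one_gt_d9
      linarith
    rw [pow_mul]
    calc (I.card : ℝ) * ((1 - 1 / (r : ℝ)) ^ r) ^ h ≤ 2 ^ h * Real.exp (-1) ^ h :=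
          mul_le_mul h3 h2 (pow_nonneg (pow_nonneg (by rw [sub_nonneg, div_le_one hrpos]; exact hr1) _) _)
            (by positivity)
      _ = (2 * Real.exp (-1)) ^ h := by rw [mul_pow]
      _ < 1 := pow_lt_one₀ (by positivity) h4 hh
  have h0 : (I.filter fun i => Disjoint K (G i)).card = 0 := by
    have : ((I.filter fun i => Disjoint K (G i)).card : ℝ) < 1 := hcard.trans_lt hlt
    have : (I.filter fun i => Disjoint K (G i)).card < 1 := by exact_mod_cast this
    omega
  intro i hi
  by_contra! hcon
  have : i ∈ I.filter fun i => Disjoint K (G i) :=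
    Finset.mem_filter.2 ⟨hi, Finset.disjoint_left.2 hcon⟩
  rw [Finset.card_eq_zero.1 h0] at this
  simp at this

end GroupCombinatorics

section BorelTools

open scoped Classical

variable {Γ : Type} [Group Γ] {X : Type} [MulAction Γ X]

/-- The points moved into `T` by some element of `F`. -/
def nbhd (F : Finset Γ) (T : Set X) : Set X := {v | ∃ f ∈ F, f • v ∈ T}

/-- No two distinct translates by elements of `F` lie in `T`. -/
def IsSeparated (F : Finset Γ) (T : Set X) : Prop := ∀ v ∈ T, ∀ f ∈ F, f • v ∈ T → f = 1

lemma subset_nbhd {F : Finset Γ} (hF : 1 ∈ F) (T : Set X) : T ⊆ nbhd F T :=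
  fun v hv => ⟨1, hF, by simpa using hv⟩

lemma nbhd_mono (F : Finset Γ) {T T' : Set X} (h : T ⊆ T') : nbhd F T ⊆ nbhd F T' :=
  fun _ ⟨f, hf, hv⟩ => ⟨f, hf, h hv⟩

lemma nbhd_union (F : Finset Γ) (T T' : Set X) : nbhd F (T ∪ T') = nbhd F T ∪ nbhd F T' := by
  ext v
  simp only [nbhd, Set.mem_ofPred_eq, Set.mem_union]
  grind

/-- In a sequence of separated sets, each avoiding the neighbourhoods of the previous ones,
elements of `F` do not move points of one set into another. -/
lemma separated_iUnion {F : Finset Γ} (hFinv : F⁻¹ = F) {T N : ℕ → Set X}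
    (hT : ∀ n, IsSeparated F (T n)) (hTN : ∀ n, Disjoint (T n) (N n))
    (hN : ∀ n, N n ⊆ N (n + 1)) (hNT : ∀ n, nbhd F (T n) ⊆ N (n + 1)) :
    IsSeparated F (⋃ n, T n) := by
  have hmono : Monotone N := monotone_nat_of_le_succ hN
  have hlt : ∀ l m, l < m → ∀ v, ∀ f ∈ F, f • v ∈ T l → v ∉ T m := by
    intro l m hlm v f hf hv hvm
    exact Set.disjoint_left.1 (hTN m) hvm (hmono hlm (hNT l ⟨f, hf, hv⟩))
  intro v hv f hf hfv
  obtain ⟨l, hl⟩ := Set.mem_iUnion.1 hv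
  obtain ⟨m, hm⟩ := Set.mem_iUnion.1 hfv
  rcases lt_trichotomy l m with h | h | h
  · exact absurd hm (hlt l m h _ f⁻¹ (by rw [← hFinv]; exact Finset.inv_mem_inv hf) (by simpa))
  · subst h
    exact hT l v hl f hf hm
  · exact absurd hl (hlt m l h v f hf hm)

/-- The elements of `B` moving `x` into `T`. -/
noncomputable def hits (B : Finset Γ) (T : Set X) (x : X) : Finset Γ := B.filter fun b => b • x ∈ T

@[simp]
lemma mem_hits {B : Finset Γ} {T : Set X} {x : X} {b : Γ} :
    b ∈ hits B T x ↔ b ∈ B ∧ b • x ∈ T := Finset.mem_filter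

lemma hits_union_card_le (B : Finset Γ) (T T' : Set X) (x : X) :
    (hits B (T ∪ T') x).card ≤ (hits B T x).card + (hits B T' x).card := by
  refine (Finset.card_le_card (t := hits B T x ∪ hits B T' x) fun b hb => ?_).trans
    (Finset.card_union_le _ _)
  simp only [mem_hits, Finset.mem_union, Set.mem_union] at hb ⊢
  tauto

lemma hits_card_mono (B : Finset Γ) {T T' : Set X} (h : T ⊆ T') (x : X) :
    (hits B T x).card ≤ (hits B T' x).card := by
  refine Finset.card_le_card fun b hb => ?_
  rw [mem_hits] at hb ⊢
  exact ⟨hb.1, h hb.2⟩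

/-- The proportion of `b ∈ B` with `b • x ∈ T` is at most `δ`, for all `x`. -/
def SparseOn (B : Finset Γ) (δ : ℝ) (T : Set X) : Prop :=
  ∀ x : X, ((hits B T x).card : ℝ) ≤ δ * B.card

lemma SparseOn.mono {B : Finset Γ} {δ δ' : ℝ} {T T' : Set X} (h : SparseOn B δ T) (hδ : δ ≤ δ')
    (hT : T' ⊆ T) : SparseOn B δ' T' := by
  intro x
  have h1 : ((hits B T' x).card : ℝ) ≤ (hits B T x).card := by
    exact_mod_cast hits_card_mono B hT x
  exact (h1.trans (h x)).trans (mul_le_mul_of_nonneg_right hδ (Nat.cast_nonneg _))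

lemma SparseOn.union {B : Finset Γ} {δ δ' : ℝ} {T T' : Set X} (h : SparseOn B δ T)
    (h' : SparseOn B δ' T') : SparseOn B (δ + δ') (T ∪ T') := by
  intro x
  have h1 : ((hits B (T ∪ T') x).card : ℝ) ≤ (hits B T x).card + (hits B T' x).card := by
    exact_mod_cast hits_union_card_le B T T' x
  have := h x
  have := h' x
  rw [add_mul]
  linarith

lemma card_filter_mul_le (B A : Finset Γ) (p : Γ → Prop) :
    ((B * A).filter p).card ≤ ∑ a ∈ A, (B.filter fun b => p (b * a)).card := by
  have : (B * A).filter p ⊆ A.biUnion fun a => (B.filter fun b => p (b * a)).image (· * a) := by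
    intro c hc
    obtain ⟨hc, hp⟩ := Finset.mem_filter.1 hc
    obtain ⟨b, hb, a, ha, rfl⟩ := Finset.mem_mul.1 hc
    exact Finset.mem_biUnion.2 ⟨a, ha, Finset.mem_image.2
      ⟨b, Finset.mem_filter.2 ⟨hb, hp⟩, rfl⟩⟩
  refine (Finset.card_le_card this).trans (Finset.card_biUnion_le.trans ?_)
  exact Finset.sum_le_sum fun a _ => Finset.card_image_le

lemma SparseOn.mul {B A : Finset Γ} {δ : ℝ} {T : Set X} (h : SparseOn B δ T)
    (hBA : (B * A).card = B.card * A.card) : SparseOn (B * A) δ T := by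
  intro x
  have h1 : (hits (B * A) T x).card ≤ ∑ a ∈ A, (hits B T (a • x)).card := by
    simpa only [hits, mul_smul] using card_filter_mul_le B A fun b => b • x ∈ T
  rw [hBA]
  calc ((hits (B * A) T x).card : ℝ) ≤ ∑ a ∈ A, ((hits B T (a • x)).card : ℝ) := by
        exact_mod_cast h1
    _ ≤ ∑ a ∈ A, δ * B.card := Finset.sum_le_sum fun a _ => h (a • x)
    _ = _ := by simp; ring

variable [MeasurableSpace X]

lemma measurableSet_nbhd [MeasurableConstSMul Γ X] (F : Finset Γ) {T : Set X}
    (hT : MeasurableSet T) : MeasurableSet (nbhd F T) := by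
  have : nbhd F T = ⋃ f ∈ F, (fun v => f • v) ⁻¹' T := by
    ext v; simp [nbhd]
  rw [this]
  exact Finset.measurableSet_biUnion _ fun f _ => measurable_const_smul f hT

lemma exists_separating_sequence (X : Type) [MeasurableSpace X]
    [MeasurableSpace.CountablySeparated X] :
    ∃ U : ℕ → Set X, (∀ n, MeasurableSet (U n)) ∧
      ∀ (x : X) (s : Finset X), x ∉ s → ∃ n, x ∈ U n ∧ ∀ y ∈ s, y ∉ U n := by
  obtain ⟨f, hf, hinj⟩ := MeasurableSpace.measurable_injection_nat_bool_of_countablySeparated X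
  obtain ⟨e, he⟩ := exists_surjective_nat (Finset ℕ × Finset ℕ)
  refine ⟨fun n => ⋂ i ∈ (e n).1, {x | f x i = decide (i ∈ (e n).2)}, fun n => ?_, ?_⟩
  · refine Finset.measurableSet_biInter _ fun i _ => ?_
    exact ((measurable_pi_apply i).comp hf) (measurableSet_singleton _)
  · intro x s hx
    have : ∀ y : X, y ∈ s → ∃ i, f x i ≠ f y i := by
      intro y hy
      by_contra! h
      exact hx (hinj (funext h) ▸ hy)
    choose i hi using this
    let I : Finset ℕ := s.attach.image fun y => i y.1 y.2
    obtain ⟨n, hn⟩ := he (I, I.filter fun j => f x j = true)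
    refine ⟨n, ?_, ?_⟩
    · simp only [hn, Set.mem_iInter, Set.mem_ofPred_eq]
      intro j hj
      simp [hj]
    · intro y hy hyU
      simp only [hn, Set.mem_iInter, Set.mem_ofPred_eq] at hyU
      have hj : i y hy ∈ I := Finset.mem_image.2 ⟨⟨y, hy⟩, Finset.mem_attach _ _, rfl⟩
      have := hyU _ hj
      apply hi y hy
      rw [this]
      simp [hj]

variable [MeasurableSpace.CountablySeparated X] [MeasurableConstSMul Γ X]

lemma exists_maximal_separated (hfree : ∀ (γ : Γ) (x : X), γ • x = x → γ = 1) (S : Finset Γ)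
    (hS1 : 1 ∈ S) (hSinv : S⁻¹ = S) {Y : Set X} (hY : MeasurableSet Y) :
    ∃ M ⊆ Y, MeasurableSet M ∧ IsSeparated S M ∧ ∀ x ∈ Y, ∃ s ∈ S, s • x ∈ M := by
  obtain ⟨U, hU, hsep⟩ := exists_separating_sequence X
  let V : ℕ → Set X := fun n => {x | x ∈ Y ∧ x ∈ U n ∧ ∀ s ∈ S, s ≠ 1 → s • x ∉ U n}
  have hV : ∀ n, MeasurableSet (V n) := by
    intro n
    have : V n = Y ∩ (U n ∩ ⋂ s ∈ S.erase 1, ((fun x => s • x) ⁻¹' U n)ᶜ) := by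
      ext x
      simp only [V, Set.mem_ofPred_eq, Set.mem_inter_iff, Set.mem_iInter, Finset.mem_erase,
        Set.mem_compl_iff, Set.mem_preimage]
      grind
    rw [this]
    exact hY.inter ((hU n).inter (Finset.measurableSet_biInter _ fun s _ =>
      (measurable_const_smul s (hU n)).compl))
  let acc : ℕ → Set X := fun n => Nat.rec ∅ (fun n a => a ∪ (V n \ nbhd S a)) n
  have hacc : ∀ n, acc (n + 1) = acc n ∪ (V n \ nbhd S (acc n)) := fun n => rfl
  have hmono : Monotone acc := monotone_nat_of_le_succ fun n => Set.subset_union_left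
  have haccY : ∀ n, acc n ⊆ Y := by
    intro n
    induction n with
    | zero => exact Set.empty_subset _
    | succ n ih => exact Set.union_subset ih fun x hx => hx.1.1
  have haccM : ∀ n, MeasurableSet (acc n) := by
    intro n
    induction n with
    | zero => exact MeasurableSet.empty
    | succ n ih => exact ih.union ((hV n).diff (measurableSet_nbhd S ih))
  refine ⟨⋃ n, acc n, Set.iUnion_subset haccY, MeasurableSet.iUnion haccM, ?_, ?_⟩
  · have key : ∀ n, IsSeparated S (acc n) := by
      intro n
      induction n with
      | zero => exact fun v hv => hv.elim
      | succ n ih =>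
        intro x hx s hs hsx
        rcases hx with hx | hx <;> rcases hsx with hsx | hsx
        · exact ih x hx s hs hsx
        · exact absurd ⟨s⁻¹, by rw [← hSinv]; exact Finset.inv_mem_inv hs, by simpa⟩ hsx.2
        · exact absurd ⟨s, hs, hsx⟩ hx.2
        · by_contra h
          exact hx.1.2.2 s hs h hsx.1.2.1
    intro x hx s hs hsx
    obtain ⟨n, hn⟩ := Set.mem_iUnion.1 hx
    obtain ⟨m, hm⟩ := Set.mem_iUnion.1 hsx
    exact key (max n m) x (hmono (le_max_left _ _) hn) s hs (hmono (le_max_right _ _) hm)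
  · intro x hx
    obtain ⟨n, hn, hn'⟩ := hsep x ((S.erase 1).image fun s => s • x) (by
      intro h
      obtain ⟨s, hs, hsx⟩ := Finset.mem_image.1 h
      exact (Finset.mem_erase.1 hs).1 (hfree s x hsx))
    have hxV : x ∈ V n := ⟨hx, hn, fun s hs h1 =>
      hn' _ (Finset.mem_image.2 ⟨s, Finset.mem_erase.2 ⟨h1, hs⟩, rfl⟩)⟩
    by_cases h : x ∈ nbhd S (acc n)
    · obtain ⟨s, hs, hsx⟩ := h
      exact ⟨s, hs, Set.mem_iUnion.2 ⟨n, hsx⟩⟩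
    · exact ⟨1, hS1, Set.mem_iUnion.2 ⟨n + 1, Or.inr ⟨by simpa using hxV, by simpa using h⟩⟩⟩

lemma exists_coloring (hfree : ∀ (γ : Γ) (x : X), γ • x = x → γ = 1) (S : Finset Γ)
    (hS1 : 1 ∈ S) (hSinv : S⁻¹ = S) :
    ∃ c : X → ℕ, Measurable c ∧ (∀ x, c x < S.card) ∧
      ∀ x, ∀ s ∈ S, s ≠ 1 → c (s • x) ≠ c x := by
  have hmax : ∀ Y : {Y : Set X // MeasurableSet Y}, ∃ M : {Y : Set X // MeasurableSet Y},
      M.1 ⊆ Y.1 ∧ IsSeparated S M.1 ∧ ∀ x ∈ Y.1, ∃ s ∈ S, s • x ∈ M.1 := by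
    rintro ⟨Y, hY⟩
    obtain ⟨M, h1, h2, h3⟩ := exists_maximal_separated hfree S hS1 hSinv hY
    exact ⟨⟨M, h2⟩, h1, h3⟩
  choose μ h1 h2 h3 using hmax
  let Y : ℕ → {Y : Set X // MeasurableSet Y} := fun n =>
    Nat.rec ⟨Set.univ, MeasurableSet.univ⟩ (fun _ Y => ⟨Y.1 \ (μ Y).1, Y.2.diff (μ Y).2⟩) n
  have hYs : ∀ n, (Y (n + 1)).1 = (Y n).1 \ (μ (Y n)).1 := fun n => rfl
  have hanti : Antitone fun n => (Y n).1 := antitone_nat_of_succ_le fun n => Set.sdiff_subset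
  have hdisj : ∀ i j, i < j → ∀ x, x ∈ (μ (Y i)).1 → x ∉ (μ (Y j)).1 := by
    intro i j hij x hx hx'
    exact (hanti (Nat.succ_le_of_lt hij) (h1 _ hx') : x ∈ (Y (i + 1)).1).2 hx
  have hcov : ∀ x, ∃ i, i < S.card ∧ x ∈ (μ (Y i)).1 := by
    intro x
    by_contra! hcon
    have hxY : ∀ i ≤ S.card, x ∈ (Y i).1 := by
      intro i
      induction i with
      | zero => exact fun _ => Set.mem_univ x
      | succ i ih => exact fun hi => ⟨ih (by omega), hcon i (by omega)⟩
    have hs : ∀ i : Fin S.card, ∃ s ∈ S, s • x ∈ (μ (Y i)).1 := fun i => h3 _ x (hxY i i.2.le)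
    choose s hsS hsx using hs
    have hinj : Function.Injective s := by
      intro i j hij
      by_contra hne
      rcases lt_or_gt_of_ne hne with h | h
      · exact hdisj i j h _ (hsx i) (hij ▸ hsx j)
      · exact hdisj j i h _ (hsx j) (hij ▸ hsx i)
    have hsub : Finset.univ.image s ⊆ S.erase 1 := by
      intro t ht
      obtain ⟨i, -, rfl⟩ := Finset.mem_image.1 ht
      refine Finset.mem_erase.2 ⟨fun h => ?_, hsS i⟩
      have := hsx i
      rw [h, one_smul] at this
      exact hcon i i.2 this
    have := Finset.card_le_card hsub
    rw [Finset.card_image_of_injective _ hinj, Finset.card_erase_of_mem hS1] at this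
    simp only [Finset.card_univ, Fintype.card_fin] at this
    have := Finset.card_pos.2 ⟨1, hS1⟩
    omega
  have hm : ∀ i, MeasurableSet {x | i < S.card ∧ x ∈ (μ (Y i)).1} := fun i =>
    (MeasurableSet.const _).inter (μ (Y i)).2
  refine ⟨fun x => Nat.find (hcov x), measurable_find hcov hm,
    fun x => (Nat.find_spec (hcov x)).1, ?_⟩
  intro x s hs hs1 heq
  apply hs1
  have ha := (Nat.find_spec (hcov x)).2
  have hb := (Nat.find_spec (hcov (s • x))).2
  simp only at heq
  rw [heq] at hb
  exact h2 _ x ha s hs hb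

/-- A family of measurable sets, few in number, separating `v` from `F • t • v`. -/
lemma exists_separating_sets (hfree : ∀ (γ : Γ) (x : X), γ • x = x → γ = 1) (F G : Finset Γ)
    (n : ℕ) (hn : 2 * (F.card * G.card) + 1 ≤ 2 ^ n) :
    ∃ E : ℕ → Set X, (∀ l, MeasurableSet (E l)) ∧
      ∀ v : X, ∀ t ∈ G, (∀ f ∈ F, f * t ≠ 1) →
        ∃ l < (n * 2) ^ F.card, v ∈ E l ∧ ∀ f ∈ F, f • t • v ∉ E l := by
  let S : Finset Γ := (F * G) ∪ (F * G)⁻¹ ∪ {1}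
  have hS : S.card ≤ 2 ^ n := by
    have h1 : (F * G).card ≤ F.card * G.card := Finset.card_mul_le
    have h2 : ((F * G)⁻¹).card = (F * G).card := Finset.card_inv _
    have h3 := Finset.card_union_le (F * G) (F * G)⁻¹
    have h4 := Finset.card_union_le ((F * G) ∪ (F * G)⁻¹) {1}
    rw [Finset.card_singleton] at h4
    change ((F * G) ∪ (F * G)⁻¹ ∪ {1}).card ≤ _
    omega
  obtain ⟨c, hc, hcS, hcs⟩ := exists_coloring (X := X) hfree S
    (by simp [S]) (by
      ext g
      simp only [S, Finset.mem_inv', Finset.mem_union, inv_inv, Finset.mem_singleton, inv_eq_one]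
      tauto)
  let e : (F → Fin n × Bool) ≃ Fin ((n * 2) ^ F.card) := Fintype.equivFinOfCardEq (by simp)
  refine ⟨fun l => if hl : l < (n * 2) ^ F.card then
    ⋂ f : F, {x | (c x).testBit (e.symm ⟨l, hl⟩ f).1 = (e.symm ⟨l, hl⟩ f).2} else ∅, ?_, ?_⟩
  · intro l
    beta_reduce
    split_ifs with hl
    · refine MeasurableSet.iInter fun f => ?_
      exact hc (t := {a | a.testBit (e.symm ⟨l, hl⟩ f).1 = (e.symm ⟨l, hl⟩ f).2}) (by measurability)
    · exact MeasurableSet.empty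
  · intro v t ht hne
    have hbit : ∀ f : F, ∃ i : Fin n, (c v).testBit i ≠ (c (f.1 • t • v)).testBit i := by
      intro f
      by_contra! h
      have hmem : f.1 * t ∈ S := by
        simp only [S, Finset.mem_union]
        exact Or.inl (Or.inl (Finset.mul_mem_mul f.2 ht))
      apply hcs v (f.1 * t) hmem (hne f.1 f.2)
      refine Nat.eq_of_testBit_eq fun i => ?_
      rw [mul_smul]
      by_cases hi : i < n
      · exact (h ⟨i, hi⟩).symm
      · have h2 : ∀ x, (c x).testBit i = false := fun x =>
          Nat.testBit_lt_two_pow (((hcS x).trans_le hS).trans_le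
            (Nat.pow_le_pow_right (by norm_num) (not_lt.1 hi)))
        rw [h2, h2]
    choose i hi using hbit
    let l := e fun f => (i f, (c v).testBit (i f))
    refine ⟨l, l.2, ?_, ?_⟩
    · simp [l]
    · intro f hf h
      simp only [l.2, dif_pos, Set.mem_iInter, Set.mem_ofPred_eq] at h
      have := h ⟨f, hf⟩
      simp only [l, Fin.eta, Equiv.symm_apply_apply] at this
      exact hi ⟨f, hf⟩ this.symm

end BorelTools

section MeasurableHitting

open scoped Classical

lemma exists_measurable_hitting {Γ X ι : Type} [Group Γ] [MeasurableSpace X] (F C : Finset Γ)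
    (hFinv : F⁻¹ = F) (I : Finset ι) (good : ι → Γ → Set X) (hgood : ∀ i c, MeasurableSet (good i c))
    (N : ℝ) (r h : ℕ) (hN : 0 < N) (hr : 2 * (C.card : ℝ) ≤ r * N)
    (hFN : 2 * (F.card : ℝ) * (r * h : ℕ) ≤ N) (hh : h ≠ 0) (hI : I.card ≤ 2 ^ h) :
    ∃ K : X → Finset Γ, (∀ x, K x ⊆ C) ∧ (∀ x, (K x).card ≤ r * h) ∧
      (∀ x, ∀ k ∈ K x, ∀ f ∈ F, f * k ∈ K x → f = 1) ∧
      (∀ x, ∀ i ∈ I, N ≤ (C.filter fun c => x ∈ good i c).card → ∃ k ∈ K x, x ∈ good i k) ∧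
      (∀ x, ∀ k ∈ K x, ∃ i ∈ I, x ∈ good i k) ∧ ∀ c, MeasurableSet {x | c ∈ K x} := by
  let G : Finset (ι × Γ) → ι → Finset Γ := fun d i => C.filter fun c => (i, c) ∈ d
  have key : ∀ d : Finset (ι × Γ), ∃ K ⊆ C, K.card ≤ r * h ∧
      (∀ k ∈ K, ∀ f ∈ F, f * k ∈ K → f = 1) ∧
      (∀ i ∈ I.filter fun i => N ≤ (G d i).card, ∃ k ∈ K, k ∈ G d i) ∧
      ∀ k ∈ K, ∃ i ∈ I.filter fun i => N ≤ (G d i).card, k ∈ G d i := by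
    intro d
    exact exists_hitting F C hFinv _ (G d) N r h hN (fun i _ => Finset.filter_subset _ _)
      (fun i hi => (Finset.mem_filter.1 hi).2) hr hFN hh
      ((Finset.card_filter_le _ _).trans hI)
  choose κ h1 h2 h3 h4 h5 using key
  let D : X → Finset (ι × Γ) := fun x => (I ×ˢ C).filter fun p => x ∈ good p.1 p.2
  have hG : ∀ x, ∀ i ∈ I, G (D x) i = C.filter fun c => x ∈ good i c := by
    intro x i hi
    ext c
    simp only [G, D, Finset.mem_filter, Finset.mem_product]
    tauto
  refine ⟨fun x => κ (D x), fun x => h1 _, fun x => h2 _, fun x => h3 _, ?_, ?_, ?_⟩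
  · intro x i hi hN
    obtain ⟨k, hk, hkG⟩ := h4 (D x) i (Finset.mem_filter.2 ⟨hi, by rwa [hG x i hi]⟩)
    rw [hG x i hi] at hkG
    exact ⟨k, hk, (Finset.mem_filter.1 hkG).2⟩
  · intro x k hk
    obtain ⟨i, hi, hkG⟩ := h5 (D x) k hk
    have hi := (Finset.mem_filter.1 hi).1
    rw [hG x i hi] at hkG
    exact ⟨i, hi, (Finset.mem_filter.1 hkG).2⟩
  · intro c
    have : {x | c ∈ κ (D x)} = ⋃ d ∈ (I ×ˢ C).powerset.filter (fun d => c ∈ κ d),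
        ⋂ p ∈ I ×ˢ C, {x | x ∈ good p.1 p.2 ↔ p ∈ d} := by
      ext x
      simp only [Set.mem_ofPred_eq, Set.mem_iUnion, Set.mem_iInter, Finset.mem_filter,
        Finset.mem_powerset]
      constructor
      · intro hx
        refine ⟨D x, ⟨Finset.filter_subset _ _, hx⟩, fun p hp => ?_⟩
        simp only [D, Finset.mem_filter, hp, true_and]
      · rintro ⟨d, ⟨hd, hc⟩, hx⟩
        have : D x = d := by
          ext p
          simp only [D, Finset.mem_filter]
          exact ⟨fun hp => (hx p hp.1).1 hp.2, fun hp => ⟨hd hp, (hx p (hd hp)).2 hp⟩⟩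
        rwa [this]
    rw [this]
    refine Finset.measurableSet_biUnion _ fun d _ => Finset.measurableSet_biInter _ fun p _ => ?_
    by_cases hp : p ∈ d
    · simpa [hp] using hgood p.1 p.2
    · have : {x | x ∈ good p.1 p.2 ↔ p ∈ d} = (good p.1 p.2)ᶜ := by
        ext x
        simp [hp]
      rw [this]
      exact (hgood p.1 p.2).compl

end MeasurableHitting

section Clusters

open scoped Classical

variable {Γ : Type} [Group Γ] {X : Type} [MulAction Γ X]

/-- The union of the clusters `K z • z` over `z ∈ M`. -/
def clusters (M : Set X) (K : X → Finset Γ) : Set X := {v | ∃ z ∈ M, ∃ c ∈ K z, v = c • z}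

lemma clusters_separated {F S C : Finset Γ} (hCS : C⁻¹ * F * C ⊆ S) {M : Set X}
    (hM : IsSeparated S M) {K : X → Finset Γ} (hKC : ∀ z, K z ⊆ C)
    (hK : ∀ z, ∀ k ∈ K z, ∀ f ∈ F, f * k ∈ K z → f = 1) : IsSeparated F (clusters M K) := by
  rintro v ⟨z, hz, c, hc, rfl⟩ f hf ⟨z', hz', c', hc', h⟩
  have h1 : z' = (c'⁻¹ * f * c) • z := by
    rw [mul_smul, mul_smul, h, inv_smul_smul]
  have h2 : c'⁻¹ * f * c = 1 := by
    refine hM z hz _ (hCS ?_) (h1 ▸ hz')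
    exact Finset.mul_mem_mul (Finset.mul_mem_mul (Finset.inv_mem_inv (hKC _ hc')) hf) (hKC _ hc)
  rw [h2, one_smul] at h1
  subst h1
  refine hK z' c hc f hf ?_
  have : f * c = c' := by
    calc f * c = c' * (c'⁻¹ * f * c) := by group
      _ = c' := by rw [h2, mul_one]
  rwa [this]

/-- A window `D` meets the neighbourhood of at most one cluster. -/
lemma hits_nbhd_clusters_card_le {F S C D : Finset Γ} (hFinv : F⁻¹ = F)
    (hCS : C⁻¹ * F * C * (C⁻¹ * F * C) ⊆ S) (hDC : D ⊆ C) {M : Set X}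
    (hM : IsSeparated S M) {K : X → Finset Γ} (hKC : ∀ z, K z ⊆ C) {s : ℕ}
    (hKs : ∀ z, (K z).card ≤ s) (x : X) :
    (hits D (nbhd F (clusters M K)) x).card ≤ F.card * s := by
  rcases (hits D (nbhd F (clusters M K)) x).eq_empty_or_nonempty with h0 | ⟨d₀, hd₀⟩
  · simp [h0]
  obtain ⟨hd₀D, f₀, hf₀, z₀, hz₀, c₀, hc₀, h₀⟩ := mem_hits.1 hd₀
  have hsub : hits D (nbhd F (clusters M K)) x ⊆
      (F ×ˢ K z₀).image fun p => p.1⁻¹ * p.2 * (c₀⁻¹ * f₀ * d₀) := by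
    intro d hd
    obtain ⟨hdD, f, hf, z, hz, c, hc, h⟩ := mem_hits.1 hd
    have e₀ : z₀ = (c₀⁻¹ * f₀ * d₀) • x := by
      rw [mul_smul, mul_smul, h₀, inv_smul_smul]
    have e : z = (c⁻¹ * f * d) • x := by
      rw [mul_smul, mul_smul, h, inv_smul_smul]
    have e' : z = (c⁻¹ * f * d * (c₀⁻¹ * f₀ * d₀)⁻¹) • z₀ := by
      rw [e, e₀, mul_smul _ (c₀⁻¹ * f₀ * d₀)⁻¹, inv_smul_smul]
    have h1 : c⁻¹ * f * d * (c₀⁻¹ * f₀ * d₀)⁻¹ = 1 := by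
      refine hM z₀ hz₀ _ (hCS (Finset.mul_mem_mul ?_ ?_)) (e' ▸ hz)
      · exact Finset.mul_mem_mul (Finset.mul_mem_mul (Finset.inv_mem_inv (hKC _ hc)) hf) (hDC hdD)
      · rw [show (c₀⁻¹ * f₀ * d₀)⁻¹ = d₀⁻¹ * f₀⁻¹ * c₀ by group]
        exact Finset.mul_mem_mul (Finset.mul_mem_mul (Finset.inv_mem_inv (hDC hd₀D))
          (by rw [← hFinv]; exact Finset.inv_mem_inv hf₀)) (hKC _ hc₀)
    rw [h1, one_smul] at e'
    subst e'
    refine Finset.mem_image.2 ⟨(f, c), Finset.mem_product.2 ⟨hf, hc⟩, ?_⟩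
    rw [← mul_inv_eq_one.1 h1]
    group
  refine (Finset.card_le_card hsub).trans (Finset.card_image_le.trans ?_)
  rw [Finset.card_product]
  exact Nat.mul_le_mul_left _ (hKs _)

lemma clusters_biUnion {ι : Type} (L : Finset ι) (M : Set X) (K : ι → X → Finset Γ) :
    clusters M (fun z => L.biUnion fun l => K l z) = ⋃ l ∈ L, clusters M (K l) := by
  ext v
  simp only [clusters, Set.mem_ofPred_eq, Finset.mem_biUnion, Set.mem_iUnion]
  constructor
  · rintro ⟨z, hz, c, ⟨l, hl, hc⟩, h⟩
    exact ⟨l, hl, z, hz, c, hc, h⟩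
  · rintro ⟨l, hl, z, hz, c, hc, h⟩
    exact ⟨z, hz, c, ⟨l, hl, hc⟩, h⟩

variable [MeasurableSpace X]

lemma measurableSet_clusters [MeasurableConstSMul Γ X] {C : Finset Γ} {M : Set X}
    (hM : MeasurableSet M) {K : X → Finset Γ} (hKC : ∀ z, K z ⊆ C)
    (hK : ∀ c, MeasurableSet {z | c ∈ K z}) : MeasurableSet (clusters M K) := by
  have : clusters M K = ⋃ c ∈ C, (fun v => c⁻¹ • v) ⁻¹' (M ∩ {z | c ∈ K z}) := by
    ext v
    simp only [clusters, Set.mem_ofPred_eq, Set.mem_iUnion, Set.mem_preimage, Set.mem_inter_iff]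
    constructor
    · rintro ⟨z, hz, c, hc, rfl⟩
      exact ⟨c, hKC z hc, by simpa using hz, by simpa using hc⟩
    · rintro ⟨c, hc, h1, h2⟩
      exact ⟨_, h1, c, h2, by simp⟩
  rw [this]
  exact Finset.measurableSet_biUnion _ fun c _ =>
    measurable_const_smul c⁻¹ (hM.inter (hK c))

end Clusters

section Stage

open scoped Classical

variable {Γ : Type} [Group Γ]

/-- If `S`-separated points are taken with `S = apart F B`, then their `B`-windows have disjoint
`F`-neighbourhoods, and every `B`-window meets at most one of these neighbourhoods. -/
noncomputable def apart (F B : Finset Γ) : Finset Γ := B⁻¹ * F * B * (B⁻¹ * F * B)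

lemma one_mem_apart {F B : Finset Γ} (hF : 1 ∈ F) (hB : B.Nonempty) : 1 ∈ apart F B := by
  obtain ⟨b, hb⟩ := hB
  have : (1 : Γ) ∈ B⁻¹ * F * B := by
    rw [show (1 : Γ) = b⁻¹ * 1 * b by group]
    exact Finset.mul_mem_mul (Finset.mul_mem_mul (Finset.inv_mem_inv hb) hF) hb
  rw [show (1 : Γ) = 1 * 1 by group]
  exact Finset.mul_mem_mul this this

lemma subset_apart {F B : Finset Γ} (hF : 1 ∈ F) (hB : B.Nonempty) :
    B⁻¹ * F * B ⊆ apart F B := by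
  obtain ⟨b, hb⟩ := hB
  have : (1 : Γ) ∈ B⁻¹ * F * B := by
    rw [show (1 : Γ) = b⁻¹ * 1 * b by group]
    exact Finset.mul_mem_mul (Finset.mul_mem_mul (Finset.inv_mem_inv hb) hF) hb
  intro x hx
  rw [show x = x * 1 by group]
  exact Finset.mul_mem_mul hx this

lemma apart_inv {F : Finset Γ} (hF : F⁻¹ = F) (B : Finset Γ) : (apart F B)⁻¹ = apart F B := by
  simp only [apart, mul_inv_rev, inv_inv, hF, mul_assoc]

lemma apart_card_le (F B : Finset Γ) : (apart F B).card ≤ F.card ^ 2 * B.card ^ 4 := by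
  have h1 : (B⁻¹ * F * B).card ≤ B.card * F.card * B.card := by
    refine Finset.card_mul_le.trans (Nat.mul_le_mul_right _ (Finset.card_mul_le.trans ?_))
    rw [Finset.card_inv]
  refine Finset.card_mul_le.trans ((Nat.mul_le_mul h1 h1).trans (le_of_eq ?_))
  ring

/-- Finite data for one stage of the construction. -/
structure Stage (Γ : Type) [Group Γ] where
  /-- Points of the constructed sets will be `F`-separated. -/
  F : Finset Γ
  /-- Window for the second points of the pairs. -/
  B : Finset Γ
  /-- Multiplicity of windows for the first points of the pairs. -/
  A : Finset Γ
  /-- The element to be encoded. -/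
  γ : Γ
  /-- Number of binary digits of colors. -/
  n : ℕ
  /-- Exponent bounding the number of requirements. -/
  h : ℕ
  /-- Inverse density parameter for second points. -/
  rQ : ℕ
  /-- Inverse density parameter for first points. -/
  rP : ℕ
  /-- Hitting threshold for second points. -/
  NQ : ℝ
  /-- Hitting threshold for first points. -/
  NP : ℝ
  one_mem : 1 ∈ F
  inv_F : F⁻¹ = F
  nonempty_B : B.Nonempty
  nonempty_A : A.Nonempty
  h_ne : h ≠ 0
  NQ_pos : 0 < NQ
  NP_pos : 0 < NP
  two_B : 2 * (B.card : ℝ) ≤ rQ * NQ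
  two_C : 2 * ((B * apart F B * A).card : ℝ) ≤ rP * NP
  F_Q : 2 * (F.card : ℝ) * (rQ * h : ℕ) ≤ NQ
  F_P : 2 * (F.card : ℝ) * (rP * h : ℕ) ≤ NP
  card_Q : (apart F B * A * apart F (B * apart F B * A)).card ≤ 2 ^ h
  card_P : (apart F (B * apart F B * A)).card ≤ 2 ^ h
  card_color : 2 * (F.card * (B * apart F B * A * apart F (B * apart F B * A)).card) + 1 ≤ 2 ^ n
  sparse_Q : (F.card : ℝ) * ((n * 2) ^ F.card * (rQ * h) : ℕ) ≤ B.card / 8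
  clean : 2 * (B.card : ℝ) * (apart F B).card * (F.card * ((n * 2) ^ F.card * (rP * h)) : ℕ) ≤
    A.card / 2
  NQ_le : ((n * 2) ^ F.card : ℕ) * NQ ≤ 3 / 8 * B.card
  NP_le : (B.card : ℝ) * (apart F B).card * (((n * 2) ^ F.card : ℕ) * NP) ≤ A.card / 2
  spread : ∀ θ : Γ, ¬ HasFiniteClass θ →
    ((B.filter fun c => c * θ * c⁻¹ ∈ F).card : ℝ) ≤ B.card / 8

namespace Stage

variable (d : Stage Γ)

/-- Separation set for second points. -/
noncomputable def SQ : Finset Γ := apart d.F d.B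

/-- Window for first points. -/
noncomputable def C : Finset Γ := d.B * d.SQ * d.A

/-- Separation set for first points. -/
noncomputable def SP : Finset Γ := apart d.F d.C

/-- The number of separating sets. -/
def L : ℕ := (d.n * 2) ^ d.F.card

lemma nonempty_C : d.C.Nonempty :=
  (d.nonempty_B.mul ⟨1, one_mem_apart d.one_mem d.nonempty_B⟩).mul d.nonempty_A

lemma inv_mem_F {f : Γ} (hf : f ∈ d.F) : f⁻¹ ∈ d.F := by
  rw [← d.inv_F]
  exact Finset.inv_mem_inv hf

variable {X : Type} [MulAction Γ X]

/-- `b • z` may serve as a second point of a pair with connecting element `g * d.γ⁻¹ * g⁻¹`. -/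
def goodQ (E N : Set X) (g b : Γ) : Set X :=
  {z | b • z ∈ E ∧ b • z ∉ N ∧ (b * g * d.γ⁻¹ * g⁻¹) • z ∉ N ∧
    (b * g * d.γ⁻¹ * g⁻¹) • z ∉ nbhd d.F E}

/-- `σ • z` may serve as a first point of a pair whose second point lies in `Q`. -/
def goodP (Q N : Set X) (u σ : Γ) : Set X :=
  {z | (σ * u * d.γ * u⁻¹) • z ∈ Q ∧ σ • z ∉ N ∧ σ • z ∉ nbhd d.F Q}

/-- The properties of the clusters constructed at one step of the recursion. -/
structure IsStep [MeasurableSpace X] (MQ MP E N : Set X) (KQ KP : X → Finset Γ) : Prop where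
  KQ_sub : ∀ z, KQ z ⊆ d.B
  KP_sub : ∀ z, KP z ⊆ d.C
  KQ_card : ∀ z, (KQ z).card ≤ d.rQ * d.h
  KP_card : ∀ z, (KP z).card ≤ d.rP * d.h
  sepQ : IsSeparated d.F (clusters MQ KQ)
  sepP : IsSeparated d.F (clusters MP KP)
  measQ : MeasurableSet (clusters MQ KQ)
  measP : MeasurableSet (clusters MP KP)
  subQ : clusters MQ KQ ⊆ E \ N
  subP : clusters MP KP ⊆ (N ∪ nbhd d.F (clusters MQ KQ))ᶜ
  hitQ : ∀ z, ∀ g ∈ d.SQ * d.A * d.SP,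
    d.NQ ≤ (d.B.filter fun b => z ∈ d.goodQ E N g b).card → ∃ b ∈ KQ z, z ∈ d.goodQ E N g b
  hitP : ∀ z, ∀ u ∈ d.SP,
    d.NP ≤ (d.C.filter fun σ => z ∈ d.goodP (clusters MQ KQ) N u σ).card →
      ∃ σ ∈ KP z, z ∈ d.goodP (clusters MQ KQ) N u σ

variable {d}

lemma IsStep.separated [MeasurableSpace X] {MQ MP E N : Set X} {KQ KP : X → Finset Γ}
    (hs : d.IsStep MQ MP E N KQ KP) : IsSeparated d.F (clusters MP KP ∪ clusters MQ KQ) := by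
  intro v hv f hf hfv
  rcases hv with hv | hv <;> rcases hfv with hfv | hfv
  · exact hs.sepP v hv f hf hfv
  · exact absurd (Or.inr ⟨f, hf, hfv⟩) (hs.subP hv)
  · exact absurd (Or.inr ⟨f⁻¹, d.inv_mem_F hf, by simpa⟩) (hs.subP hfv)
  · exact hs.sepQ v hv f hf hfv

lemma IsStep.disjoint_right [MeasurableSpace X] {MQ MP E N : Set X} {KQ KP : X → Finset Γ}
    (hs : d.IsStep MQ MP E N KQ KP) : Disjoint (clusters MP KP ∪ clusters MQ KQ) N := by
  rw [Set.disjoint_left]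
  rintro v (hv | hv) hN
  · exact hs.subP hv (Or.inl hN)
  · exact (hs.subQ hv).2 hN

lemma IsStep.disjoint [MeasurableSpace X] {MQ MP E N : Set X} {KQ KP : X → Finset Γ}
    (hs : d.IsStep MQ MP E N KQ KP) : Disjoint (clusters MP KP) (clusters MQ KQ) := by
  rw [Set.disjoint_left]
  exact fun v hv hQ => hs.subP hv (Or.inr (subset_nbhd d.one_mem _ hQ))

variable (d)
variable [MeasurableSpace X] [MeasurableConstSMul Γ X]

lemma measurableSet_goodQ {E N : Set X} (hE : MeasurableSet E) (hN : MeasurableSet N) (g b : Γ) :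
    MeasurableSet (d.goodQ E N g b) :=
  (measurable_const_smul b hE).inter ((measurable_const_smul b hN.compl).inter
    ((measurable_const_smul (b * g * d.γ⁻¹ * g⁻¹) hN.compl).inter
      (measurable_const_smul (b * g * d.γ⁻¹ * g⁻¹) (measurableSet_nbhd d.F hE).compl)))

lemma measurableSet_goodP {Q N : Set X} (hQ : MeasurableSet Q) (hN : MeasurableSet N) (u σ : Γ) :
    MeasurableSet (d.goodP Q N u σ) :=
  (measurable_const_smul (σ * u * d.γ * u⁻¹) hQ).inter
    ((measurable_const_smul σ hN.compl).inter
      (measurable_const_smul σ (measurableSet_nbhd d.F hQ).compl))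

lemma exists_isStep {MQ MP E N : Set X} (hMQ : MeasurableSet MQ) (hMP : MeasurableSet MP)
    (hE : MeasurableSet E) (hN : MeasurableSet N) (hMQ' : IsSeparated d.SQ MQ)
    (hMP' : IsSeparated d.SP MP) : ∃ KQ KP : X → Finset Γ, d.IsStep MQ MP E N KQ KP := by
  obtain ⟨KQ, q1, q2, q3, q4, q5, q6⟩ := exists_measurable_hitting d.F d.B d.inv_F
    (d.SQ * d.A * d.SP) (d.goodQ E N) (d.measurableSet_goodQ hE hN) d.NQ d.rQ d.h d.NQ_pos
    d.two_B d.F_Q d.h_ne d.card_Q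
  have hQ := measurableSet_clusters hMQ q1 q6
  obtain ⟨KP, p1, p2, p3, p4, p5, p6⟩ := exists_measurable_hitting d.F d.C d.inv_F
    d.SP (d.goodP (clusters MQ KQ) N) (d.measurableSet_goodP hQ hN) d.NP d.rP d.h d.NP_pos
    d.two_C d.F_P d.h_ne d.card_P
  refine ⟨KQ, KP, q1, p1, q2, p2,
    clusters_separated (subset_apart d.one_mem d.nonempty_B) hMQ' q1 q3,
    clusters_separated (subset_apart d.one_mem d.nonempty_C) hMP' p1 p3,
    hQ, measurableSet_clusters hMP p1 p6, ?_, ?_, q4, p4⟩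
  · rintro _ ⟨z, hz, c, hc, rfl⟩
    obtain ⟨g, -, h1, h2, -⟩ := q5 z c hc
    exact ⟨h1, h2⟩
  · rintro _ ⟨z, hz, c, hc, rfl⟩
    obtain ⟨g, -, -, h1, h2⟩ := p5 z c hc
    simp only [Set.mem_compl_iff, Set.mem_union, not_or]
    exact ⟨h1, h2⟩

lemma exists_steps {MQ MP N₀ : Set X} {E : ℕ → Set X} (hMQ : MeasurableSet MQ)
    (hMP : MeasurableSet MP) (hE : ∀ l, MeasurableSet (E l)) (hN₀ : MeasurableSet N₀)
    (hMQ' : IsSeparated d.SQ MQ) (hMP' : IsSeparated d.SP MP) :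
    ∃ (N : ℕ → Set X) (KQ KP : ℕ → X → Finset Γ), N 0 = N₀ ∧
      (∀ l, N (l + 1) = N l ∪ nbhd d.F (clusters MP (KP l) ∪ clusters MQ (KQ l))) ∧
      ∀ l, d.IsStep MQ MP (E l) (N l) (KQ l) (KP l) := by
  have : ∀ (l : ℕ) (N : {N : Set X // MeasurableSet N}), ∃ KQ KP : X → Finset Γ,
      d.IsStep MQ MP (E l) N.1 KQ KP :=
    fun l N => d.exists_isStep hMQ hMP (hE l) N.2 hMQ' hMP'
  choose KQ KP hK using this
  let N : ℕ → {N : Set X // MeasurableSet N} := fun l => Nat.rec ⟨N₀, hN₀⟩ (fun l N =>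
    ⟨N.1 ∪ nbhd d.F (clusters MP (KP l N) ∪ clusters MQ (KQ l N)), N.2.union
      (measurableSet_nbhd d.F ((hK l N).measP.union (hK l N).measQ))⟩) l
  exact ⟨fun l => (N l).1, fun l => KQ l (N l), fun l => KP l (N l), rfl, fun l => rfl,
    fun l => hK l (N l)⟩

end Stage

end Stage

section StageConstruction

open scoped Classical

namespace Stage

variable {Γ : Type} [Group Γ] (d : Stage Γ) {X : Type} [MulAction Γ X]

lemma bad_card_le (hγ : d.γ ∉ exceptional d.F) (g : Γ) :
    ((d.B.filter fun c => c * (g * d.γ * g⁻¹) * c⁻¹ ∈ d.F).card : ℝ) ≤ d.B.card / 8 := by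
  by_cases h : HasFiniteClass (g * d.γ * g⁻¹)
  · have : (d.B.filter fun c => c * (g * d.γ * g⁻¹) * c⁻¹ ∈ d.F) = ∅ := by
      refine Finset.filter_eq_empty_iff.2 fun c _ hc => hγ ⟨hasFiniteClass_conj.1 h, c * g, ?_⟩
      convert hc using 1
      group
    rw [this]
    simp only [Finset.card_empty, Nat.cast_zero]
    positivity
  · exact d.spread _ h

lemma exists_many_goodQ (hγ : d.γ ∉ exceptional d.F) {E N : ℕ → Set X} {Nall : Set X}
    (hN : ∀ l < d.L, N l ⊆ Nall)
    (hE : ∀ v : X, ∀ c ∈ d.C * d.SP, (∀ f ∈ d.F, f * (c * d.γ⁻¹ * c⁻¹) ≠ 1) →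
      ∃ l < d.L, v ∈ E l ∧ ∀ f ∈ d.F, f • (c * d.γ⁻¹ * c⁻¹) • v ∉ E l)
    {x : X} {g : Γ} (hg : ∀ b ∈ d.B, b * g ∈ d.C * d.SP)
    (h1 : ((hits d.B Nall (g • x)).card : ℝ) ≤ d.B.card / 4)
    (h2 : ((hits d.B Nall (g • d.γ • x)).card : ℝ) ≤ d.B.card / 4) :
    ∃ l < d.L, d.NQ ≤ (d.B.filter fun b => g • d.γ • x ∈ d.goodQ (E l) (N l) g b).card := by
  by_contra! hcon
  let good : ℕ → Finset Γ := fun l =>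
    d.B.filter fun b => g • d.γ • x ∈ d.goodQ (E l) (N l) g b
  let bad : Finset Γ := d.B.filter fun c => c * (g * d.γ * g⁻¹) * c⁻¹ ∈ d.F
  have hsub : d.B ⊆ hits d.B Nall (g • x) ∪ hits d.B Nall (g • d.γ • x) ∪ bad ∪
      (Finset.range d.L).biUnion good := by
    intro b hb
    by_contra hbad
    simp only [Finset.mem_union, not_or, mem_hits, hb, true_and, bad, good, Finset.mem_filter,
      Finset.mem_biUnion, not_exists, not_and, Finset.mem_range] at hbad
    obtain ⟨⟨⟨b1, b2⟩, b3⟩, b4⟩ := hbad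
    obtain ⟨l, hl, hv, hfv⟩ := hE (b • g • d.γ • x) (b * g) (hg b hb) (by
      intro f hf hft
      apply b3
      have : b * (g * d.γ * g⁻¹) * b⁻¹ = f := by
        rw [eq_comm, ← mul_inv_eq_one, ← hft]
        group
      rwa [this])
    have e1 : (b * g * d.γ⁻¹ * g⁻¹) • g • d.γ • x = b • g • x := by
      simp only [mul_smul, inv_smul_smul]
    have e2 : (b * g * d.γ⁻¹ * (b * g)⁻¹) • b • g • d.γ • x = b • g • x := by
      simp only [mul_smul, mul_inv_rev, inv_smul_smul]
    rw [e2] at hfv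
    refine b4 l hl ⟨hv, fun h => b2 (hN l hl h), ?_, ?_⟩
    · rw [e1]
      exact fun h => b1 (hN l hl h)
    · rw [e1]
      rintro ⟨f, hf, h⟩
      exact hfv f hf h
  have hcard : (d.B.card : ℝ) ≤ (hits d.B Nall (g • x)).card +
      (hits d.B Nall (g • d.γ • x)).card + bad.card + ∑ l ∈ Finset.range d.L, (good l).card := by
    have i1 := Finset.card_le_card hsub
    have i2 := Finset.card_union_le (hits d.B Nall (g • x) ∪ hits d.B Nall (g • d.γ • x) ∪ bad)
      ((Finset.range d.L).biUnion good)
    have i3 := Finset.card_union_le (hits d.B Nall (g • x) ∪ hits d.B Nall (g • d.γ • x)) bad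
    have i4 := Finset.card_union_le (hits d.B Nall (g • x)) (hits d.B Nall (g • d.γ • x))
    have i5 : ((Finset.range d.L).biUnion good).card ≤ ∑ l ∈ Finset.range d.L, (good l).card :=
      Finset.card_biUnion_le
    exact_mod_cast (by omega : d.B.card ≤ (hits d.B Nall (g • x)).card +
      (hits d.B Nall (g • d.γ • x)).card + bad.card + ∑ l ∈ Finset.range d.L, (good l).card)
  have hbad : (bad.card : ℝ) ≤ d.B.card / 8 := d.bad_card_le hγ g
  have hB : (0 : ℝ) < d.B.card := by exact_mod_cast d.nonempty_B.card_pos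
  have hL : (Finset.range d.L).Nonempty := by
    rw [Finset.nonempty_iff_ne_empty]
    intro h
    rw [h] at hcard
    simp only [Finset.sum_empty, Nat.cast_zero] at hcard
    linarith
  have hsum : ∑ l ∈ Finset.range d.L, ((good l).card : ℝ) < d.L * d.NQ := by
    have := Finset.sum_lt_sum_of_nonempty hL
      (f := fun l => ((good l).card : ℝ)) (g := fun _ => d.NQ)
      fun l hl => hcon l (Finset.mem_range.1 hl)
    simpa using this
  have hle : (d.L : ℝ) * d.NQ ≤ 3 / 8 * d.B.card := d.NQ_le
  push_cast at hcard
  linarith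

/-- The elements of `A` for which some translated window meets `T`. -/
noncomputable def unclean (T : Set X) (y : X) : Finset Γ :=
  (d.B ×ˢ d.SQ).biUnion fun p => d.A.filter fun a => (p.1 * p.2 * a) • y ∈ T

lemma unclean_card_le {T : Set X} {y : X} {s : ℕ} (h : (hits d.C T y).card ≤ s) :
    (d.unclean T y).card ≤ d.B.card * d.SQ.card * s := by
  refine Finset.card_biUnion_le.trans ((Finset.sum_le_card_nsmul _ _ s ?_).trans ?_)
  · rintro ⟨b, u⟩ hp
    rw [Finset.mem_product] at hp
    refine le_trans ?_ h
    refine Finset.card_le_card_of_injOn (fun a => b * u * a) ?_ fun a _ a' _ haa' => ?_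
    · intro a ha
      rw [Finset.mem_coe, Finset.mem_filter] at ha
      rw [Finset.mem_coe, mem_hits]
      exact ⟨Finset.mul_mem_mul (Finset.mul_mem_mul hp.1 hp.2) ha.1, ha.2⟩
    · exact mul_left_cancel haa'
  · rw [Finset.card_product, smul_eq_mul]

lemma exists_encoding (hγ : d.γ ∉ exceptional d.F) {MQ MP : Set X} [MeasurableSpace X]
    {E N : ℕ → Set X} {KQ KP : ℕ → X → Finset Γ} {P Nall : Set X}
    (hMQ : ∀ x, ∃ s ∈ d.SQ, s • x ∈ MQ) (hMP : ∀ x, ∃ s ∈ d.SP, s • x ∈ MP)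
    (hE : ∀ v : X, ∀ c ∈ d.C * d.SP, (∀ f ∈ d.F, f * (c * d.γ⁻¹ * c⁻¹) ≠ 1) →
      ∃ l < d.L, v ∈ E l ∧ ∀ f ∈ d.F, f • (c * d.γ⁻¹ * c⁻¹) • v ∉ E l)
    (hK : ∀ l, d.IsStep MQ MP (E l) (N l) (KQ l) (KP l))
    (hN : ∀ l < d.L, N l ⊆ Nall ∪ nbhd d.F P)
    (hNall : ∀ x : X, ((hits d.B Nall x).card : ℝ) ≤ d.B.card / 4)
    (hP : ∀ x : X, (hits d.C (nbhd d.F P) x).card ≤ d.F.card * (d.L * (d.rP * d.h))) (x : X) :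
    ∃ l < d.L, ∃ σ ∈ d.C * d.SP, σ • x ∈ clusters MP (KP l) ∧
      (σ * d.γ) • x ∈ clusters MQ (KQ l) := by
  obtain ⟨u, hu, hux⟩ := hMP x
  let good : ℕ → Finset Γ := fun l =>
    d.C.filter fun σ => u • x ∈ d.goodP (clusters MQ (KQ l)) (N l) u σ
  by_cases hgood : ∃ l < d.L, d.NP ≤ (good l).card
  · obtain ⟨l, hl, hlN⟩ := hgood
    obtain ⟨σ, hσ, hσ'⟩ := (hK l).hitP (u • x) u hu hlN
    refine ⟨l, hl, σ * u, Finset.mul_mem_mul ((hK l).KP_sub _ hσ) hu, ?_, ?_⟩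
    · exact ⟨u • x, hux, σ, hσ, mul_smul _ _ _⟩
    · have := hσ'.1
      simpa only [mul_smul, inv_smul_smul] using this
  exfalso
  push Not at hgood
  let clean : Finset Γ := d.A \ (d.unclean (nbhd d.F P) (u • x) ∪
    d.unclean (nbhd d.F P) (u • d.γ • x))
  have hclean : (d.A.card : ℝ) / 2 ≤ clean.card := by
    have h1 := d.unclean_card_le (hP (u • x))
    have h2 := d.unclean_card_le (hP (u • d.γ • x))
    have h3 := Finset.card_union_le (d.unclean (nbhd d.F P) (u • x))
      (d.unclean (nbhd d.F P) (u • d.γ • x))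
    have h4 := Finset.le_card_sdiff (d.unclean (nbhd d.F P) (u • x) ∪
      d.unclean (nbhd d.F P) (u • d.γ • x)) d.A
    have h5 : d.A.card ≤ clean.card +
        2 * (d.B.card * d.SQ.card * (d.F.card * (d.L * (d.rP * d.h)))) := by
      change _ - _ ≤ clean.card at h4
      omega
    have h6 : (d.A.card : ℝ) ≤ clean.card +
        2 * (d.B.card * d.SQ.card * (d.F.card * (d.L * (d.rP * d.h)) : ℕ)) := by exact_mod_cast h5
    have h7 : 2 * (d.B.card : ℝ) * d.SQ.card * (d.F.card * (d.L * (d.rP * d.h)) : ℕ) ≤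
      d.A.card / 2 := d.clean
    linarith
  have hsub : clean ⊆ (Finset.range d.L).biUnion fun l => (d.B ×ˢ d.SQ).biUnion fun p =>
      (good l).image fun σ => (p.1 * p.2)⁻¹ * σ := by
    intro a ha
    simp only [clean, Finset.mem_sdiff, Finset.mem_union, not_or, unclean, Finset.mem_biUnion,
      Finset.mem_product, Finset.mem_filter, not_exists, not_and] at ha
    obtain ⟨haA, ha1, ha2⟩ := ha
    obtain ⟨u', hu', hMu'⟩ := hMQ (a • u • d.γ • x)
    have hgC : ∀ b ∈ d.B, b * (u' * a * u) ∈ d.C * d.SP := by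
      intro b hb
      rw [show b * (u' * a * u) = b * u' * a * u by group]
      exact Finset.mul_mem_mul (Finset.mul_mem_mul (Finset.mul_mem_mul hb hu') haA) hu
    have hhits : ∀ y : X, (∀ b ∈ d.B, (b * u' * a) • u • y ∉ nbhd d.F P) →
        ((hits d.B (Nall ∪ nbhd d.F P) ((u' * a * u) • y)).card : ℝ) ≤ d.B.card / 4 := by
      intro y hy
      refine le_trans ?_ (hNall ((u' * a * u) • y))
      have : hits d.B (nbhd d.F P) ((u' * a * u) • y) = ∅ := by
        refine Finset.eq_empty_of_forall_notMem fun b hb => ?_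
        rw [mem_hits] at hb
        refine hy b hb.1 ?_
        simpa only [mul_smul] using hb.2
      have h1 := hits_union_card_le d.B Nall (nbhd d.F P) ((u' * a * u) • y)
      rw [this, Finset.card_empty, add_zero] at h1
      exact_mod_cast h1
    obtain ⟨l, hl, hlN⟩ := d.exists_many_goodQ hγ hN hE hgC
      (hhits x fun b hb => ha1 (b, u') ⟨hb, hu'⟩ haA)
      (hhits (d.γ • x) fun b hb => ha2 (b, u') ⟨hb, hu'⟩ haA)
    have hz : (u' * a * u) • d.γ • x ∈ MQ := by simpa only [mul_smul] using hMu'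
    obtain ⟨b, hb, hbg⟩ := (hK l).hitQ _ (u' * a * u)
      (Finset.mul_mem_mul (Finset.mul_mem_mul hu' haA) hu) hlN
    have hbB := (hK l).KQ_sub _ hb
    have e1 : (b * (u' * a * u) * d.γ⁻¹ * (u' * a * u)⁻¹) • (u' * a * u) • d.γ • x =
        (b * u' * a) • u • x := by
      simp only [mul_smul, mul_inv_rev, inv_smul_smul]
    have e2 : b • (u' * a * u) • d.γ • x = (b * u' * a * u * d.γ * u⁻¹) • u • x := by
      simp only [mul_smul, inv_smul_smul]
    obtain ⟨g1, g2, g3, g4⟩ := hbg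
    rw [e1] at g3 g4
    simp only [Finset.mem_biUnion, Finset.mem_range, Finset.mem_product, Finset.mem_image]
    refine ⟨l, hl, (b, u'), ⟨hbB, hu'⟩, b * u' * a, Finset.mem_filter.2 ⟨?_, ?_, g3, ?_⟩,
      by group⟩
    · exact Finset.mul_mem_mul (Finset.mul_mem_mul hbB hu') haA
    · rw [← e2]
      exact ⟨_, hz, b, hb, rfl⟩
    · exact fun h => g4 (nbhd_mono d.F (fun v hv => ((hK l).subQ hv).1) h)
  have hA : (0 : ℝ) < d.A.card := by exact_mod_cast d.nonempty_A.card_pos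
  have hL : (Finset.range d.L).Nonempty := by
    rw [Finset.nonempty_iff_ne_empty]
    intro h
    rw [h, Finset.biUnion_empty, Finset.subset_empty] at hsub
    rw [hsub] at hclean
    simp only [Finset.card_empty, Nat.cast_zero] at hclean
    linarith
  have hcard : (clean.card : ℝ) ≤
      (d.B.card : ℝ) * d.SQ.card * ∑ l ∈ Finset.range d.L, ((good l).card : ℝ) := by
    have h1 : clean.card ≤ ∑ l ∈ Finset.range d.L, d.B.card * d.SQ.card * (good l).card := by
      refine (Finset.card_le_card hsub).trans (Finset.card_biUnion_le.trans ?_)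
      refine Finset.sum_le_sum fun l _ => Finset.card_biUnion_le.trans ?_
      refine (Finset.sum_le_card_nsmul _ _ (good l).card fun p _ => Finset.card_image_le).trans ?_
      rw [Finset.card_product, smul_eq_mul]
    rw [← Finset.mul_sum] at h1
    exact_mod_cast h1
  have hsum : ∑ l ∈ Finset.range d.L, ((good l).card : ℝ) < d.L * d.NP := by
    have := Finset.sum_lt_sum_of_nonempty hL
      (f := fun l => ((good l).card : ℝ)) (g := fun _ => d.NP)
      fun l hl => hgood l (Finset.mem_range.1 hl)
    simpa using this
  have hpos : (0 : ℝ) < d.B.card * d.SQ.card := by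
    have h1 : 0 < d.B.card := d.nonempty_B.card_pos
    have h2 : 0 < d.SQ.card := Finset.card_pos.2 ⟨1, one_mem_apart d.one_mem d.nonempty_B⟩
    positivity
  have h1 := mul_lt_mul_of_pos_left hsum hpos
  have h2 : (d.B.card : ℝ) * d.SQ.card * (d.L * d.NP) ≤ d.A.card / 2 := d.NP_le
  linarith

variable [MeasurableSpace X] [MeasurableSpace.CountablySeparated X] [MeasurableConstSMul Γ X]

lemma exists_pair (hfree : ∀ (γ : Γ) (x : X), γ • x = x → γ = 1) {N₀ : Set X}
    (hN₀ : MeasurableSet N₀) (hsp : SparseOn d.B (1 / 8) N₀) :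
    ∃ P Q : Set X, MeasurableSet P ∧ MeasurableSet Q ∧ Disjoint P Q ∧
      IsSeparated d.F (P ∪ Q) ∧ Disjoint (P ∪ Q) N₀ ∧
      (∀ x, (hits d.B (nbhd d.F Q) x).card ≤ d.F.card * (d.L * (d.rQ * d.h))) ∧
      (∀ D ⊆ d.C, ∀ x, (hits D (nbhd d.F P) x).card ≤ d.F.card * (d.L * (d.rP * d.h))) ∧
      (d.γ ∉ exceptional d.F → ∀ x, ∃ σ ∈ d.C * d.SP, σ • x ∈ P ∧ (σ * d.γ) • x ∈ Q) := by
  obtain ⟨MQ, -, hMQ, hMQsep, hMQmax⟩ := exists_maximal_separated (X := X) hfree d.SQ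
    (one_mem_apart d.one_mem d.nonempty_B) (apart_inv d.inv_F _) MeasurableSet.univ
  obtain ⟨MP, -, hMP, hMPsep, hMPmax⟩ := exists_maximal_separated (X := X) hfree d.SP
    (one_mem_apart d.one_mem d.nonempty_C) (apart_inv d.inv_F _) MeasurableSet.univ
  obtain ⟨E, hE, hEsep⟩ := exists_separating_sets (X := X) hfree d.F
    ((d.C * d.SP).image fun c => c * d.γ⁻¹ * c⁻¹) d.n (by
      refine le_trans ?_ d.card_color
      have := Finset.card_image_le (s := d.C * d.SP) (f := fun c => c * d.γ⁻¹ * c⁻¹)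
      exact Nat.add_le_add_right (Nat.mul_le_mul_left _ (Nat.mul_le_mul_left _ this)) 1)
  obtain ⟨N, KQ, KP, hN0, hNs, hK⟩ := d.exists_steps hMQ hMP hE hN₀ hMQsep hMPsep
  let P : Set X := ⋃ l ∈ Finset.range d.L, clusters MP (KP l)
  let Q : Set X := ⋃ l ∈ Finset.range d.L, clusters MQ (KQ l)
  have hsub : ∀ l < d.L, clusters MP (KP l) ⊆ P ∧ clusters MQ (KQ l) ⊆ Q := fun l hl =>
    ⟨Set.subset_biUnion_of_mem (u := fun l => clusters MP (KP l)) (Finset.mem_range.2 hl),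
      Set.subset_biUnion_of_mem (u := fun l => clusters MQ (KQ l)) (Finset.mem_range.2 hl)⟩
  have hN1 : ∀ l, N l ⊆ N (l + 1) := fun l => hNs l ▸ Set.subset_union_left
  have hN2 : ∀ l, nbhd d.F (clusters MP (KP l) ∪ clusters MQ (KQ l)) ⊆ N (l + 1) :=
    fun l => hNs l ▸ Set.subset_union_right
  have hmono : Monotone N := monotone_nat_of_le_succ hN1
  have hPQ : P ∪ Q ⊆ ⋃ l, clusters MP (KP l) ∪ clusters MQ (KQ l) := by
    refine Set.union_subset (Set.iUnion₂_subset fun l _ => ?_) (Set.iUnion₂_subset fun l _ => ?_)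
    · exact Set.subset_union_left.trans (Set.subset_iUnion
        (fun l => clusters MP (KP l) ∪ clusters MQ (KQ l)) l)
    · exact Set.subset_union_right.trans (Set.subset_iUnion
        (fun l => clusters MP (KP l) ∪ clusters MQ (KQ l)) l)
  have hdisj : ∀ l m, l < m → ∀ v ∈ clusters MP (KP l) ∪ clusters MQ (KQ l),
      v ∉ clusters MP (KP m) ∪ clusters MQ (KQ m) := fun l m hlm v hv hv' =>
    Set.disjoint_left.1 (hK m).disjoint_right hv'
      (hmono (Nat.succ_le_of_lt hlm) (hN2 l (subset_nbhd d.one_mem _ hv)))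
  have hQhits : ∀ x, (hits d.B (nbhd d.F Q) x).card ≤ d.F.card * (d.L * (d.rQ * d.h)) := by
    intro x
    rw [show Q = _ from (clusters_biUnion (Finset.range d.L) MQ KQ).symm]
    refine hits_nbhd_clusters_card_le d.inv_F subset_rfl subset_rfl hMQsep
      (fun z => Finset.biUnion_subset.2 fun l _ => (hK l).KQ_sub z) (fun z => ?_) x
    refine Finset.card_biUnion_le.trans
      ((Finset.sum_le_card_nsmul _ _ _ fun l _ => (hK l).KQ_card z).trans ?_)
    rw [Finset.card_range, smul_eq_mul]
  have hPhits : ∀ D ⊆ d.C, ∀ x,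
      (hits D (nbhd d.F P) x).card ≤ d.F.card * (d.L * (d.rP * d.h)) := by
    intro D hD x
    rw [show P = _ from (clusters_biUnion (Finset.range d.L) MP KP).symm]
    refine hits_nbhd_clusters_card_le d.inv_F subset_rfl hD hMPsep
      (fun z => Finset.biUnion_subset.2 fun l _ => (hK l).KP_sub z) (fun z => ?_) x
    refine Finset.card_biUnion_le.trans
      ((Finset.sum_le_card_nsmul _ _ _ fun l _ => (hK l).KP_card z).trans ?_)
    rw [Finset.card_range, smul_eq_mul]
  refine ⟨P, Q, Finset.measurableSet_biUnion _ fun l _ => (hK l).measP,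
    Finset.measurableSet_biUnion _ fun l _ => (hK l).measQ, ?_, ?_, ?_, hQhits, hPhits, ?_⟩
  · rw [Set.disjoint_left]
    intro v hv hv'
    obtain ⟨l, -, hl⟩ := Set.mem_iUnion₂.1 hv
    obtain ⟨m, -, hm⟩ := Set.mem_iUnion₂.1 hv'
    rcases lt_trichotomy l m with h | h | h
    · exact hdisj l m h v (Or.inl hl) (Or.inr hm)
    · subst h
      exact Set.disjoint_left.1 (hK l).disjoint hl hm
    · exact hdisj m l h v (Or.inr hm) (Or.inl hl)
  · have := separated_iUnion d.inv_F (fun l => (hK l).separated) (fun l => (hK l).disjoint_right)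
      hN1 hN2
    exact fun v hv f hf hfv => this v (hPQ hv) f hf (hPQ hfv)
  · rw [Set.disjoint_left]
    intro v hv hvN
    obtain ⟨l, hl⟩ := Set.mem_iUnion.1 (hPQ hv)
    exact Set.disjoint_left.1 (hK l).disjoint_right hl (hmono (Nat.zero_le l) (hN0 ▸ hvN))
  · intro hγ x
    have hNl : ∀ l ≤ d.L, N l ⊆ (N₀ ∪ nbhd d.F Q) ∪ nbhd d.F P := by
      intro l
      induction l with
      | zero => exact fun _ => hN0 ▸ fun v hv => Or.inl (Or.inl hv)
      | succ l ih =>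
        intro hl
        rw [hNs, nbhd_union]
        refine Set.union_subset (ih (by omega)) (Set.union_subset ?_ ?_)
        · exact (nbhd_mono d.F (hsub l hl).1).trans Set.subset_union_right
        · exact (nbhd_mono d.F (hsub l hl).2).trans
            (Set.subset_union_right.trans Set.subset_union_left)
    have hNall : ∀ x : X, ((hits d.B (N₀ ∪ nbhd d.F Q) x).card : ℝ) ≤ d.B.card / 4 := by
      intro x
      have h1 : ((hits d.B (N₀ ∪ nbhd d.F Q) x).card : ℝ) ≤
          (hits d.B N₀ x).card + (hits d.B (nbhd d.F Q) x).card := by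
        exact_mod_cast hits_union_card_le d.B N₀ (nbhd d.F Q) x
      have h2 := hsp x
      have h3 : ((hits d.B (nbhd d.F Q) x).card : ℝ) ≤
          d.F.card * (d.L * (d.rQ * d.h) : ℕ) := by exact_mod_cast hQhits x
      have h4 : (d.F.card : ℝ) * (d.L * (d.rQ * d.h) : ℕ) ≤ d.B.card / 8 := d.sparse_Q
      linarith
    obtain ⟨l, hl, σ, hσ, h1, h2⟩ := d.exists_encoding hγ (fun x => hMQmax x (Set.mem_univ x))
      (fun x => hMPmax x (Set.mem_univ x))
      (fun v c hc => hEsep v _ (Finset.mem_image_of_mem _ hc)) hK (fun l hl => hNl l hl.le)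
      hNall (hPhits d.C subset_rfl) x
    exact ⟨σ, hσ, (hsub l hl).1 h1, (hsub l hl).2 h2⟩

end Stage

end StageConstruction

section StageExistence

open scoped Classical

lemma exists_mul_pow_le_two_pow (K e : ℕ) : ∃ h : ℕ, 1 ≤ h ∧ K * h ^ e ≤ 2 ^ h := by
  have h1 := tendsto_pow_const_div_const_pow_of_one_lt e (one_lt_two (α := ℝ))
  have h2 : (0 : ℝ) < 1 / (K + 1) := by positivity
  obtain ⟨h, hh, hh1⟩ := ((h1.eventually (gt_mem_nhds h2)).and
    (Filter.eventually_ge_atTop 1)).exists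
  refine ⟨h, hh1, ?_⟩
  rw [div_lt_div_iff₀ (by positivity) (by positivity), one_mul] at hh
  have h3 : (h : ℝ) ^ e * (K + 1) = K * h ^ e + h ^ e := by ring
  have h4 : (0 : ℝ) ≤ (h : ℝ) ^ e := by positivity
  have : (K : ℝ) * h ^ e ≤ 2 ^ h := by linarith
  exact_mod_cast this

lemma exists_exponent (φ β₀ c : ℕ) : ∃ h : ℕ, 1 ≤ h ∧
    208 * φ * ((13 * h * 2) ^ φ) ^ 2 * ((4 * c * ((13 * h * 2) ^ φ) ^ 2 * h * β₀) *
      (φ ^ 2 * (4 * c * ((13 * h * 2) ^ φ) ^ 2 * h * β₀) ^ 4)) ^ 3 * h ≤ 2 ^ h := by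
  obtain ⟨h, h1, h2⟩ := exists_mul_pow_le_two_pow
    (208 * φ ^ 7 * (4 * c * β₀) ^ 15 * (26 ^ φ) ^ 32) (φ * 32 + 16)
  refine ⟨h, h1, le_trans (le_of_eq ?_) h2⟩
  rw [show 13 * h * 2 = 26 * h by ring, mul_pow 26 h φ, pow_add, pow_mul]
  ring

lemma stage_card_bounds {φ h L β σ κ p cq col α W V : ℕ} (hφ : 1 ≤ φ) (hβ : 1 ≤ β)
    (hh : 1 ≤ h) (hL : 1 ≤ L) (hV : V = φ ^ 2 * β ^ 4) (hW : W = β * V) (hσV : σ ≤ V)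
    (hκ : κ ≤ β * σ * α) (hp : p ≤ φ ^ 2 * κ ^ 4) (hcq : cq ≤ σ * α * p) (hcol : col ≤ κ * p)
    (H : 208 * φ * L ^ 2 * W ^ 3 * h ≤ α) :
    cq ≤ α ^ 13 ∧ p ≤ α ^ 13 ∧ 2 * (φ * col) + 1 ≤ α ^ 13 ∧ κ ≤ W * α := by
  have hV1 : 1 ≤ V := by rw [hV]; exact Nat.one_le_iff_ne_zero.2 (by positivity)
  have hVW : V ≤ W := by rw [hW]; exact Nat.le_mul_of_pos_left _ (by omega)
  have hφV : φ ^ 2 ≤ V := by rw [hV]; exact Nat.le_mul_of_pos_right _ (by positivity)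
  have hW1 : 1 ≤ W := hV1.trans hVW
  have hα : 208 * (φ * W) ≤ α := by
    refine le_trans ?_ H
    calc 208 * (φ * W) = 208 * φ * 1 ^ 2 * (W * 1 ^ 2) * 1 := by ring
      _ ≤ 208 * φ * L ^ 2 * (W * W ^ 2) * h := by gcongr
      _ = _ := by ring
  have hWα : W ≤ α := by nlinarith
  have hφα : 208 * φ ≤ α := by nlinarith
  have hα1 : 1 ≤ α := by omega
  have hκW : κ ≤ W * α := hκ.trans (by rw [hW]; gcongr)
  have hκα : κ ≤ α ^ 2 := hκW.trans (by rw [sq]; gcongr)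
  have hpα : p ≤ α ^ 9 := by
    refine hp.trans ?_
    calc φ ^ 2 * κ ^ 4 ≤ α * (α ^ 2) ^ 4 := by gcongr; omega
      _ = α ^ 9 := by ring
  have hcolα : col ≤ α ^ 11 := hcol.trans (by
    calc κ * p ≤ α ^ 2 * α ^ 9 := by gcongr
      _ = α ^ 11 := by ring)
  refine ⟨hcq.trans ?_, hpα.trans (Nat.pow_le_pow_right hα1 (by norm_num)), ?_, hκW⟩
  · calc σ * α * p ≤ α * α * α ^ 9 := by gcongr; omega
      _ = α ^ 11 := by ring
      _ ≤ α ^ 13 := Nat.pow_le_pow_right hα1 (by norm_num)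
  · have h1 : φ * col ≤ φ * α ^ 11 := by gcongr
    have h2 : 1 ≤ α ^ 11 := Nat.one_le_pow _ _ hα1
    have h3 : 208 * φ * α ^ 11 ≤ α * α ^ 11 := by gcongr
    have h4 : α ^ 12 ≤ α ^ 13 := Nat.pow_le_pow_right hα1 (by norm_num)
    have h5 : α * α ^ 11 = α ^ 12 := by ring
    nlinarith

lemma stage_parameters {φ b c h L β σ κ p cq col α : ℕ} {ε : ℝ} (hε : 0 < ε)
    (hc1 : 208 * φ ≤ c) (hc2 : 52 * (φ : ℝ) ≤ c * ε) (hφ : 1 ≤ φ) (hb : 1 ≤ b) (hh : 1 ≤ h)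
    (hL : 1 ≤ L) (hσ1 : 1 ≤ σ) (hβ : β = 4 * c * L ^ 2 * h * b) (hσ : σ ≤ φ ^ 2 * β ^ 4)
    (hκ : κ ≤ β * σ * α) (hp : p ≤ φ ^ 2 * κ ^ 4) (hcq : cq ≤ σ * α * p) (hcol : col ≤ κ * p)
    (H : 208 * φ * L ^ 2 * (β * (φ ^ 2 * β ^ 4)) ^ 3 * h ≤ α) :
    ∃ NP NQ : ℝ, ∃ rP rQ : ℕ, 0 < NQ ∧ 0 < NP ∧
      2 * (β : ℝ) ≤ rQ * NQ ∧
      2 * (κ : ℝ) ≤ rP * NP ∧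
      2 * (φ : ℝ) * (rQ * (13 * h) : ℕ) ≤ NQ ∧
      2 * (φ : ℝ) * (rP * (13 * h) : ℕ) ≤ NP ∧
      cq ≤ α ^ 13 ∧ p ≤ α ^ 13 ∧ 2 * (φ * col) + 1 ≤ α ^ 13 ∧
      (φ : ℝ) * (L * (rQ * (13 * h)) : ℕ) ≤ β / 8 ∧
      2 * (β : ℝ) * σ * (φ * (L * (rP * (13 * h))) : ℕ) ≤ α / 2 ∧
      (L : ℝ) * NQ ≤ 3 / 8 * β ∧
      (β : ℝ) * σ * (L * NP) ≤ α / 2 ∧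
      (b : ℝ) ≤ β / 8 ∧
      ((φ * (L * (rQ * (13 * h))) : ℕ) : ℝ) ≤ ε / 2 * β ∧
      ((φ * (L * (rP * (13 * h))) : ℕ) : ℝ) ≤ ε / 2 * (β * α) := by
  have hc : 208 ≤ c := by omega
  have hβ1 : 1 ≤ β := by
    rw [hβ]; exact Nat.one_le_iff_ne_zero.2 (by positivity)
  obtain ⟨V, hV⟩ : ∃ V, V = φ ^ 2 * β ^ 4 := ⟨_, rfl⟩
  obtain ⟨W, hW⟩ : ∃ W, W = β * V := ⟨_, rfl⟩
  rw [← hV, ← hW] at H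
  rw [← hV] at hσ
  obtain ⟨h1, h2, h3, h4⟩ := stage_card_bounds hφ hβ1 hh hL hV hW hσ hκ hp hcq hcol H
  have hV1 : 1 ≤ V := hσ1.trans hσ
  have hW1 : 1 ≤ W := by rw [hW]; exact Nat.one_le_iff_ne_zero.2 (by positivity)
  have hβσ : β * σ ≤ W := by rw [hW]; gcongr
  have hα1 : 1 ≤ α := le_trans (Nat.one_le_iff_ne_zero.2 (by positivity)) H
  have hbβ : 8 * b ≤ β := by
    rw [hβ]
    calc 8 * b ≤ 4 * 208 * 1 ^ 2 * 1 * b := by omega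
      _ ≤ _ := by gcongr
  rify at hc1 hb hh hL hβ H h4 hV1 hW1 hβσ hα1 hbβ hβ1 hφ hc
  have hβσ0 : (0 : ℝ) ≤ β * σ := by positivity
  have hβε : 1 ≤ ε * β := by
    have : (1 : ℝ) ≤ c * ε := by linarith
    have h5 : (1 : ℝ) ≤ L ^ 2 * h * b := by
      have := one_le_pow₀ hL (n := 2)
      nlinarith [one_le_mul_of_one_le_of_one_le this hh]
    rw [hβ]
    nlinarith
  have hX : (0 : ℝ) < 208 * φ * L ^ 2 * W ^ 2 * h := by positivity
  have hXα : (208 * φ * L ^ 2 * W ^ 2 * h : ℝ) ≤ α := by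
    refine le_trans ?_ H
    have : (W : ℝ) ^ 2 ≤ W ^ 3 := pow_le_pow_right₀ hW1 (by norm_num)
    gcongr
  have hY : (0 : ℝ) < L ^ 2 * h * b := by positivity
  have hLL : (L : ℝ) * h ≤ L ^ 2 * h * b := by
    have : (1 : ℝ) ≤ L * b := one_le_mul_of_one_le_of_one_le hL hb
    have h0 : (0 : ℝ) ≤ L * h := by positivity
    nlinarith
  have hYh : (L : ℝ) ^ 2 * h ≤ L ^ 2 * h * b := le_mul_of_one_le_right (by positivity) hb
  refine ⟨α / (2 * L * W), b * c * L * h, 4 * L * W ^ 2, 8 * L, by positivity, by positivity,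
    ?_, ?_, ?_, ?_, h1, h2, h3, ?_, ?_, ?_, ?_, ?_, ?_, ?_⟩
  · push_cast; rw [hβ]; exact le_of_eq (by ring)
  · push_cast
    have : (4 * L * W ^ 2 : ℝ) * (α / (2 * L * W)) = 2 * (W * α) := by field_simp; ring
    linarith
  · push_cast
    have : (208 * φ : ℝ) * (b * (L * h)) ≤ c * (b * (L * h)) := by gcongr
    have h0 : (φ : ℝ) * (L * h) * 1 ≤ φ * (L * h) * b := by gcongr
    linarith
  · push_cast
    rw [le_div_iff₀ (by positivity)]
    linarith
  · push_cast
    have : (208 * φ : ℝ) * (L ^ 2 * h * b) ≤ c * (L ^ 2 * h * b) := by gcongr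
    have h0 : (φ : ℝ) * (L ^ 2 * h) ≤ φ * (L ^ 2 * h * b) := by gcongr
    rw [hβ]; linarith
  · push_cast
    have : (β * σ : ℝ) * (208 * φ * L ^ 2 * W ^ 2 * h) ≤ W * (208 * φ * L ^ 2 * W ^ 2 * h) := by
      gcongr
    linarith
  · rw [hβ]; nlinarith
  · have : (β : ℝ) * σ * (L * (α / (2 * L * W))) = β * σ * (α / (2 * W)) := by field_simp
    rw [this]
    calc (β : ℝ) * σ * (α / (2 * W)) ≤ W * (α / (2 * W)) := by gcongr
      _ = α / 2 := by field_simp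
  · linarith
  · push_cast
    have : (52 * φ : ℝ) * (L ^ 2 * h * b) ≤ c * ε * (L ^ 2 * h * b) := by gcongr
    have h0 : (φ : ℝ) * (L ^ 2 * h) ≤ φ * (L ^ 2 * h * b) := by gcongr
    rw [hβ]; linarith
  · push_cast
    have : (1 : ℝ) * α ≤ ε * β * α := by gcongr
    linarith

variable {Γ : Type} [Group Γ]

lemma exists_stage [Infinite Γ] (F B₀ : Finset Γ) (hF1 : 1 ∈ F) (hFinv : F⁻¹ = F)
    (hB₀ : B₀.Nonempty) (ε : ℝ) (hε : 0 < ε) (γ : Γ) :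
    ∃ d : Stage Γ, d.F = F ∧ d.γ = γ ∧
      (∃ A₁ : Finset Γ, d.B = B₀ * A₁ ∧ (B₀ * A₁).card = B₀.card * A₁.card) ∧
      (d.B * d.A).card = d.B.card * d.A.card ∧
      ((F.card * (d.L * (d.rQ * d.h)) : ℕ) : ℝ) ≤ ε / 2 * d.B.card ∧
      ((F.card * (d.L * (d.rP * d.h)) : ℕ) : ℝ) ≤ ε / 2 * (d.B.card * d.A.card) := by
  obtain ⟨c, hc1, hc2⟩ : ∃ c : ℕ, 208 * F.card ≤ c ∧ 52 * (F.card : ℝ) ≤ c * ε := by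
    obtain ⟨n, hn⟩ := exists_nat_ge (52 * (F.card : ℝ) / ε)
    refine ⟨max n (208 * F.card), le_max_right _ _, ?_⟩
    rw [← div_le_iff₀ hε]
    exact hn.trans (by exact_mod_cast le_max_left _ _)
  have hφ : 1 ≤ F.card := Finset.card_pos.2 ⟨1, hF1⟩
  have hβ₀ : 1 ≤ B₀.card := hB₀.card_pos
  obtain ⟨h, hh, H⟩ := exists_exponent F.card B₀.card c
  obtain ⟨A₁, hA₁, hB, hsp⟩ := exists_spread F B₀ (4 * c * ((13 * h * 2) ^ F.card) ^ 2 * h)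
  obtain ⟨A, hA, hBA, -⟩ := exists_spread F (B₀ * A₁) (2 ^ h)
  have hL : 1 ≤ (13 * h * 2) ^ F.card := Nat.one_le_pow _ _ (by omega)
  have hσ := apart_card_le F (B₀ * A₁)
  have hκ : (B₀ * A₁ * apart F (B₀ * A₁) * A).card ≤
      (B₀ * A₁).card * (apart F (B₀ * A₁)).card * A.card :=
    Finset.card_mul_le.trans (Nat.mul_le_mul_right _ Finset.card_mul_le)
  have hπ := apart_card_le F (B₀ * A₁ * apart F (B₀ * A₁) * A)
  have hQ : (apart F (B₀ * A₁) * A * apart F (B₀ * A₁ * apart F (B₀ * A₁) * A)).card ≤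
      (apart F (B₀ * A₁)).card * A.card * (apart F (B₀ * A₁ * apart F (B₀ * A₁) * A)).card :=
    Finset.card_mul_le.trans (Nat.mul_le_mul_right _ Finset.card_mul_le)
  have hcol : (B₀ * A₁ * apart F (B₀ * A₁) * A *
      apart F (B₀ * A₁ * apart F (B₀ * A₁) * A)).card ≤
      (B₀ * A₁ * apart F (B₀ * A₁) * A).card *
        (apart F (B₀ * A₁ * apart F (B₀ * A₁) * A)).card := Finset.card_mul_le
  have hβ : (B₀ * A₁).card = 4 * c * ((13 * h * 2) ^ F.card) ^ 2 * h * B₀.card := by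
    rw [hB]; ring
  rw [← hβ] at H
  have hBne : (B₀ * A₁).Nonempty := by
    rw [← Finset.card_pos, hβ]
    have : 0 < c := by omega
    positivity
  have hAne : A.Nonempty := by rw [← Finset.card_pos, hA]; positivity
  have hσ1 : 1 ≤ (apart F (B₀ * A₁)).card := Finset.card_pos.2 ⟨1, one_mem_apart hF1 hBne⟩
  have hα13 : 2 ^ (13 * h) = (2 ^ h) ^ 13 := by rw [← pow_mul, mul_comm]
  rw [← hA] at H hα13
  obtain ⟨NP, NQ, rP, rQ, hNQ, hNP, h1, h2, h3, h4, h5, h6, h7, h8, h9, h10, h11, h12, h13, h14⟩ :=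
    stage_parameters hε hc1 hc2 hφ hβ₀ hh hL hσ1 hβ hσ hκ hπ hQ hcol H
  rw [← hα13] at h5 h6 h7
  refine ⟨⟨F, B₀ * A₁, A, γ, 13 * h, 13 * h, rQ, rP, NQ, NP, hF1, hFinv, hBne, hAne, by omega, hNQ,
    hNP, h1, h2, h3, h4, h5, h6, h7, h8, h9, ?_, ?_, ?_⟩, rfl, rfl, ⟨A₁, rfl, ?_⟩, ?_, h13, h14⟩
  · exact_mod_cast h10
  · exact_mod_cast h11
  · intro θ hθ
    exact le_trans (by exact_mod_cast hsp θ hθ) h12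
  · rw [hB, hA₁]
  · change (B₀ * A₁ * A).card = (B₀ * A₁).card * A.card
    rw [hBA, hA]

end StageExistence

section PairSequence

open scoped Classical

variable {Γ : Type} [Group Γ]

/-- `P` and `Q` are disjoint measurable sets avoiding `N` whose union is `F`-separated. -/
structure IsPair {X : Type} [MulAction Γ X] [MeasurableSpace X] (F : Finset Γ) (N P Q : Set X) :
    Prop where
  measP : MeasurableSet P
  measQ : MeasurableSet Q
  disj : Disjoint P Q
  sep : IsSeparated F (P ∪ Q)
  avoid : Disjoint (P ∪ Q) N

/-- Every point has a translate by `σ ∈ D` in `P` whose companion by `σ * γ` lies in `Q`. -/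
def Links {X : Type} [MulAction Γ X] (D : Finset Γ) (γ : Γ) (P Q : Set X) : Prop :=
  ∀ x, ∃ σ ∈ D, σ • x ∈ P ∧ (σ * γ) • x ∈ Q

lemma exists_linking_pair [Infinite Γ] (F : Finset Γ) (hF1 : 1 ∈ F) (hFinv : F⁻¹ = F)
    (B : Finset Γ) (ε : ℝ) (hε : 0 < ε) (γ : Γ) :
    ∃ A D : Finset Γ, B.Nonempty → A.Nonempty ∧ (B * A).card = B.card * A.card ∧
      ∀ (X : Type) [MulAction Γ X] [MeasurableSpace X] [MeasurableSpace.CountablySeparated X]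
        [MeasurableConstSMul Γ X], (∀ (γ : Γ) (x : X), γ • x = x → γ = 1) →
        ∀ N : Set X, MeasurableSet N → SparseOn B (1 / 8) N →
        ∃ P Q : Set X, IsPair F N P Q ∧ SparseOn (B * A) ε (nbhd F (P ∪ Q)) ∧
          (γ ∉ exceptional F → Links D γ P Q) := by
  by_cases hB : B.Nonempty
  swap
  · exact ⟨∅, ∅, fun h => (hB h).elim⟩
  obtain ⟨d, rfl, rfl, ⟨A₁, hdB, hA₁⟩, hdA, hQ, hP⟩ := exists_stage F B hF1 hFinv hB ε hε γ
  have hA₁ne : A₁.Nonempty := by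
    have := d.nonempty_B
    rw [hdB] at this
    exact this.of_mul_right
  have hcard : (B * (A₁ * d.A)).card = B.card * (A₁ * d.A).card := by
    refine le_antisymm Finset.card_mul_le ?_
    rw [← mul_assoc, ← hdB, hdA, hdB, hA₁, mul_assoc]
    exact Nat.mul_le_mul_left _ Finset.card_mul_le
  refine ⟨A₁ * d.A, d.C * d.SP, fun _ => ⟨hA₁ne.mul d.nonempty_A, hcard, ?_⟩⟩
  intro X _ _ _ _ hfree N hN hsp
  obtain ⟨P, Q, h1, h2, h3, h4, h5, h6, h7, h8⟩ :=
    d.exists_pair (X := X) hfree hN (by rw [hdB]; exact hsp.mul hA₁)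
  refine ⟨P, Q, ⟨h1, h2, h3, h4, h5⟩, ?_, h8⟩
  rw [← mul_assoc, ← hdB, nbhd_union]
  have hQs : SparseOn (d.B * d.A) (ε / 2) (nbhd d.F Q) :=
    SparseOn.mul (fun x => le_trans (by exact_mod_cast h6 x) hQ) hdA
  have hPs : SparseOn (d.B * d.A) (ε / 2) (nbhd d.F P) := by
    intro x
    rw [hdA]
    push_cast
    have hsub : d.B * d.A ⊆ d.C := by
      refine Finset.mul_subset_mul_right fun b hb => ?_
      rw [← mul_one b]
      exact Finset.mul_mem_mul hb (one_mem_apart d.one_mem d.nonempty_B)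
    exact le_trans (by exact_mod_cast h7 _ hsub x) hP
  exact (hPs.union hQs).mono (by linarith) subset_rfl

lemma exists_pair_sequence [Infinite Γ] (F : Finset Γ) (hF1 : 1 ∈ F) (hFinv : F⁻¹ = F)
    (B₀ : Finset Γ) (hB₀ : B₀.Nonempty) (γ : ℕ → Γ) :
    ∃ D : ℕ → Finset Γ,
      ∀ (X : Type) [MulAction Γ X] [MeasurableSpace X] [MeasurableSpace.CountablySeparated X]
        [MeasurableConstSMul Γ X], (∀ (γ : Γ) (x : X), γ • x = x → γ = 1) →
        ∀ N : Set X, MeasurableSet N → SparseOn B₀ (1 / 16) N →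
        ∃ P Q : Set X, IsPair F N P Q ∧ ∀ n, γ n ∉ exceptional F → Links (D n) (γ n) P Q := by
  choose A D hAD using fun (n : ℕ) (B : Finset Γ) => exists_linking_pair F hF1 hFinv B
    ((1 / 2) ^ (n + 5)) (by positivity) (γ n)
  let B : ℕ → Finset Γ := fun n => Nat.rec B₀ (fun n B => B * A n B) n
  have hBne : ∀ n, (B n).Nonempty := by
    intro n
    induction n with
    | zero => exact hB₀
    | succ n ih => exact ih.mul (hAD n _ ih).1
  refine ⟨fun n => D n (B n), ?_⟩
  intro X _ _ _ _ hfree N₀ hN₀ hsp₀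
  have key : ∀ (n : ℕ) (N : Set X), ∃ P Q : Set X, MeasurableSet N ∧ SparseOn (B n) (1 / 8) N →
      IsPair F N P Q ∧ SparseOn (B (n + 1)) ((1 / 2) ^ (n + 5)) (nbhd F (P ∪ Q)) ∧
        (γ n ∉ exceptional F → Links (D n (B n)) (γ n) P Q) := by
    intro n N
    by_cases h : MeasurableSet N ∧ SparseOn (B n) (1 / 8) N
    · obtain ⟨P, Q, h1⟩ := (hAD n _ (hBne n)).2.2 X hfree N h.1 h.2
      exact ⟨P, Q, fun _ => h1⟩
    · exact ⟨∅, ∅, fun h1 => (h h1).elim⟩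
  choose P Q hPQ using key
  let N : ℕ → Set X := fun n => Nat.rec N₀ (fun n N => N ∪ nbhd F (P n N ∪ Q n N)) n
  have hNsucc : ∀ n, N (n + 1) = N n ∪ nbhd F (P n (N n) ∪ Q n (N n)) := fun n => rfl
  have hN : ∀ n, MeasurableSet (N n) ∧ SparseOn (B n) (1 / 8 - (1 / 2) ^ (n + 4)) (N n) := by
    intro n
    induction n with
    | zero => exact ⟨hN₀, hsp₀.mono (by norm_num) subset_rfl⟩
    | succ n ih =>
      have hpos : (0 : ℝ) ≤ (1 / 2) ^ (n + 4) := by positivity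
      obtain ⟨h1, h2, -⟩ := hPQ n (N n) ⟨ih.1, ih.2.mono (by linarith) subset_rfl⟩
      refine ⟨ih.1.union (measurableSet_nbhd F (h1.measP.union h1.measQ)), ?_⟩
      rw [hNsucc]
      refine (SparseOn.union (ih.2.mul (hAD n _ (hBne n)).2.1) h2).mono (le_of_eq ?_) subset_rfl
      ring
  have h : ∀ n, IsPair F (N n) (P n (N n)) (Q n (N n)) ∧
      (γ n ∉ exceptional F → Links (D n (B n)) (γ n) (P n (N n)) (Q n (N n))) := by
    intro n
    have hpos : (0 : ℝ) ≤ (1 / 2) ^ (n + 4) := by positivity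
    obtain ⟨h1, -, h3⟩ := hPQ n (N n) ⟨(hN n).1, (hN n).2.mono (by linarith) subset_rfl⟩
    exact ⟨h1, h3⟩
  have hmono : Monotone N := monotone_nat_of_le_succ fun n => Set.subset_union_left
  have hsub : ∀ n, P n (N n) ∪ Q n (N n) ⊆ N (n + 1) := fun n =>
    (subset_nbhd hF1 _).trans Set.subset_union_right
  have hU : (⋃ n, P n (N n)) ∪ (⋃ n, Q n (N n)) = ⋃ n, (P n (N n) ∪ Q n (N n)) :=
    Set.iUnion_union_distrib _ _ |>.symm
  refine ⟨⋃ n, P n (N n), ⋃ n, Q n (N n), ⟨MeasurableSet.iUnion fun n => (h n).1.measP,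
    MeasurableSet.iUnion fun n => (h n).1.measQ, ?_, ?_, ?_⟩, ?_⟩
  · rw [Set.disjoint_left]
    intro x hx hx'
    obtain ⟨n, hn⟩ := Set.mem_iUnion.1 hx
    obtain ⟨m, hm⟩ := Set.mem_iUnion.1 hx'
    rcases lt_trichotomy n m with hlt | rfl | hlt
    · exact Set.disjoint_left.1 (h m).1.avoid (Or.inr hm) (hmono hlt (hsub n (Or.inl hn)))
    · exact Set.disjoint_left.1 (h n).1.disj hn hm
    · exact Set.disjoint_left.1 (h n).1.avoid (Or.inl hn) (hmono hlt (hsub m (Or.inr hm)))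
  · rw [hU]
    exact separated_iUnion hFinv (fun n => (h n).1.sep) (fun n => (h n).1.avoid)
      (fun n => Set.subset_union_left) fun n => Set.subset_union_right
  · rw [hU, Set.disjoint_iUnion_left]
    exact fun n => (h n).1.avoid.mono_right (hmono (Nat.zero_le n))
  · intro n hn x
    obtain ⟨σ, h1, h2, h3⟩ := (h n).2 hn x
    exact ⟨σ, h1, Set.mem_iUnion.2 ⟨n, h2⟩, Set.mem_iUnion.2 ⟨n, h3⟩⟩

end PairSequence

section Patterns

open scoped Classical

lemma exists_measurable_prescribed {X A ι : Type} [MeasurableSpace X] [MeasurableSpace A]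
    (a₀ : A) (I : Finset ι) (T : ι → Set X) (a : ι → A) (hT : ∀ i ∈ I, MeasurableSet (T i))
    (hcompat : ∀ i ∈ I, ∀ j ∈ I, ∀ x ∈ T i, x ∈ T j → a i = a j) :
    ∃ c : X → A, Measurable c ∧ ∀ i ∈ I, ∀ x ∈ T i, c x = a i := by
  induction I using Finset.induction_on with
  | empty => exact ⟨fun _ => a₀, measurable_const, by simp⟩
  | insert i I hi ih =>
    obtain ⟨c, hc, h⟩ := ih (fun j hj => hT j (Finset.mem_insert_of_mem hj))
      fun j hj l hl => hcompat j (Finset.mem_insert_of_mem hj) l (Finset.mem_insert_of_mem hl)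
    refine ⟨fun x => if x ∈ T i then a i else c x,
      Measurable.ite (hT i (Finset.mem_insert_self i I)) measurable_const hc, ?_⟩
    intro j hj x hx
    by_cases hxi : x ∈ T i
    · simp only [hxi, if_true]
      exact hcompat i (Finset.mem_insert_self i I) j hj x hxi hx
    · simp only [hxi, if_false]
      rcases Finset.mem_insert.1 hj with rfl | hj
      · exact (hxi hx).elim
      · exact h j hj x hx

variable {Γ : Type} [Group Γ]

/-- In every orbit the pair of patterns `p`, `q` on `W` links `γ`, except for exceptional `γ`, and
the pattern `r` on `E` appears syndetically. -/
structure Realizes {X A : Type} [MulAction Γ X] (W E U : Finset Γ) (D : Γ → Finset Γ)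
    (p q r : Γ → A) (c : X → A) : Prop where
  linked : ∀ γ, γ ∉ exceptional (W⁻¹ * W) → ∀ x, ∃ σ ∈ D γ,
    (∀ w ∈ W, c (w • σ • x) = p w) ∧ ∀ w ∈ W, c (w • (σ * γ) • x) = q w
  syndetic : ∀ x, ∃ u ∈ U, ∀ e ∈ E, c (e • u • x) = r e

lemma inv_mul_smul_inv {X : Type} [MulAction Γ X] (a b : Γ) (x : X) :
    (a⁻¹ * b) • b⁻¹ • x = a⁻¹ • x := by
  rw [mul_smul, smul_inv_smul]

theorem exists_realization [Countable Γ] [Infinite Γ] {A : Type} [MeasurableSpace A]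
    (W E : Finset Γ) (hW : W.Nonempty) (p q r : Γ → A) :
    ∃ (U : Finset Γ) (D : Γ → Finset Γ),
      ∀ (X : Type) [MulAction Γ X] [MeasurableSpace X] [MeasurableSpace.CountablySeparated X]
        [MeasurableConstSMul Γ X], (∀ (γ : Γ) (x : X), γ • x = x → γ = 1) →
        ∃ c : X → A, Measurable c ∧ Realizes W E U D p q r c := by
  have hF1 : ∀ V : Finset Γ, V.Nonempty → 1 ∈ V⁻¹ * V := by
    rintro V ⟨v, hv⟩
    rw [← inv_mul_cancel v]
    exact Finset.mul_mem_mul (Finset.inv_mem_inv hv) hv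
  have hFinv : ∀ V : Finset Γ, (V⁻¹ * V)⁻¹ = V⁻¹ * V := fun V => by rw [mul_inv_rev, inv_inv]
  obtain ⟨R, hR⟩ : ∃ R, R = (W ∪ E)⁻¹ * (W ∪ E) := ⟨_, rfl⟩
  have hR1 : 1 ∈ R := hR ▸ hF1 _ (hW.mono Finset.subset_union_left)
  have hRinv : R⁻¹ = R := hR ▸ hFinv _
  have hRmem : ∀ a ∈ W ∪ E, ∀ b ∈ W ∪ E, a⁻¹ * b ∈ R := fun a ha b hb =>
    hR ▸ Finset.mul_mem_mul (Finset.inv_mem_inv ha) hb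
  obtain ⟨B₁, hB₁⟩ := Infinite.exists_subset_card_eq Γ (16 * R.card)
  obtain ⟨B, hB⟩ : ∃ B, B = insert 1 B₁ := ⟨_, rfl⟩
  have hB1 : 1 ∈ B := hB ▸ Finset.mem_insert_self _ _
  have hBcard : 16 * R.card ≤ B.card :=
    hB₁ ▸ hB ▸ Finset.card_le_card (Finset.subset_insert _ _)
  obtain ⟨g, hg⟩ := exists_surjective_nat Γ
  obtain ⟨D, hD⟩ := exists_pair_sequence (W⁻¹ * W) (hF1 W hW) (hFinv W) B ⟨1, hB1⟩ g
  refine ⟨apart R B, fun γ => D (Function.surjInv hg γ), ?_⟩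
  intro X _ _ _ _ hfree
  obtain ⟨M, -, hM, hMsep, hMmax⟩ := exists_maximal_separated (X := X) hfree (apart R B)
    (one_mem_apart hR1 ⟨1, hB1⟩) (apart_inv hRinv B) MeasurableSet.univ
  have hMsepR : IsSeparated R M := by
    intro v hv f hf
    refine hMsep v hv f (subset_apart hR1 ⟨1, hB1⟩ ?_)
    rw [show f = 1⁻¹ * f * 1 by group]
    exact Finset.mul_mem_mul (Finset.mul_mem_mul (Finset.inv_mem_inv hB1) hf) hB1
  have hsparse : SparseOn B (1 / 16) (nbhd R M) := by
    intro x
    have hcl : clusters M (fun _ => {(1 : Γ)}) = M := by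
      ext v
      simp [clusters]
    have := hits_nbhd_clusters_card_le (D := B) hRinv subset_rfl subset_rfl hMsep
      (K := fun _ => {(1 : Γ)}) (s := 1) (fun _ => by simpa using hB1) (fun _ => by simp) x
    rw [hcl] at this
    have h2 : (16 * (hits B (nbhd R M) x).card : ℝ) ≤ B.card := by
      exact_mod_cast (by omega : 16 * (hits B (nbhd R M) x).card ≤ B.card)
    linarith
  obtain ⟨P, Q, hPQ, hlinks⟩ := hD X hfree (nbhd R M) (measurableSet_nbhd R hM) hsparse
  have hWW : ∀ v ∈ W, ∀ w ∈ W, ∀ x : X, v⁻¹ • x ∈ P ∪ Q → w⁻¹ • x ∈ P ∪ Q → w = v := by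
    intro v hv w hw x hvx hwx
    have := hPQ.sep _ hwx (v⁻¹ * w) (Finset.mul_mem_mul (Finset.inv_mem_inv hv) hw)
      (by rwa [inv_mul_smul_inv])
    exact (inv_mul_eq_one.1 this).symm
  have hWE : ∀ w ∈ W, ∀ e ∈ E, ∀ x : X, w⁻¹ • x ∈ P ∪ Q → e⁻¹ • x ∈ M → False := by
    intro w hw e he x hwx hex
    refine Set.disjoint_left.1 hPQ.avoid hwx ⟨e⁻¹ * w, ?_, by rwa [inv_mul_smul_inv]⟩
    exact hRmem _ (Finset.mem_union_right _ he) _ (Finset.mem_union_left _ hw)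
  have hEE : ∀ d ∈ E, ∀ e ∈ E, ∀ x : X, d⁻¹ • x ∈ M → e⁻¹ • x ∈ M → e = d := by
    intro d hd e he x hdx hex
    have := hMsepR _ hex (d⁻¹ * e) (hRmem _ (Finset.mem_union_right _ hd) _
      (Finset.mem_union_right _ he)) (by rwa [inv_mul_smul_inv])
    exact (inv_mul_eq_one.1 this).symm
  have hPQdis : ∀ v ∈ W, ∀ w ∈ W, ∀ x : X, v⁻¹ • x ∈ P → w⁻¹ • x ∈ Q → False := by
    intro v hv w hw x hvx hwx
    obtain rfl := hWW v hv w hw x (Or.inl hvx) (Or.inr hwx)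
    exact Set.disjoint_left.1 hPQ.disj hvx hwx
  obtain ⟨c, hc, hcI⟩ := exists_measurable_prescribed (X := X) (p 1)
    (W.disjSum (W.disjSum E))
    (Sum.elim (fun w => {x | w⁻¹ • x ∈ P}) (Sum.elim (fun w => {x | w⁻¹ • x ∈ Q})
      fun e => {x | e⁻¹ • x ∈ M}))
    (Sum.elim p (Sum.elim q r)) (by
      rintro (w | w | w) -
      · exact measurable_const_smul w⁻¹ hPQ.measP
      · exact measurable_const_smul w⁻¹ hPQ.measQ
      · exact measurable_const_smul w⁻¹ hM) (by
      rintro (v | v | v) hv (w | w | w) hw x hvx hwx <;>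
      simp only [Finset.inl_mem_disjSum, Finset.inr_mem_disjSum, Sum.elim_inl, Sum.elim_inr,
        Set.mem_ofPred_eq] at hv hw hvx hwx ⊢
      · rw [hWW v hv w hw x (Or.inl hvx) (Or.inl hwx)]
      · exact (hPQdis v hv w hw x hvx hwx).elim
      · exact (hWE v hv w hw x (Or.inl hvx) hwx).elim
      · exact (hPQdis w hw v hv x hwx hvx).elim
      · rw [hWW v hv w hw x (Or.inr hvx) (Or.inr hwx)]
      · exact (hWE v hv w hw x (Or.inr hvx) hwx).elim
      · exact (hWE w hw v hv x (Or.inl hwx) hvx).elim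
      · exact (hWE w hw v hv x (Or.inr hwx) hvx).elim
      · rw [hEE v hv w hw x hvx hwx])
  refine ⟨c, hc, ?_, ?_⟩
  · intro γ hγ x
    obtain ⟨σ, hσ, hP, hQ⟩ := hlinks (Function.surjInv hg γ)
      (by rwa [Function.surjInv_eq hg γ]) x
    rw [Function.surjInv_eq hg γ] at hQ
    refine ⟨σ, hσ, fun w hw => ?_, fun w hw => ?_⟩
    · exact hcI (Sum.inl w) (by simpa using hw) _ (by simpa using hP)
    · exact hcI (Sum.inr (Sum.inl w)) (by simpa using hw) _ (by simpa using hQ)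
  · intro x
    obtain ⟨u, hu, hux⟩ := hMmax x (Set.mem_univ x)
    exact ⟨u, hu, fun e he => hcI (Sum.inr (Sum.inr e)) (by simpa using he) _ (by simpa using hux)⟩

end Patterns

section Shift

/-- `x` and `z` agree on `W`. -/
def AgreeOn {Γ A : Type*} (W : Finset Γ) (x z : Γ → A) : Prop := ∀ w ∈ W, x w = z w

lemma AgreeOn.mono {Γ A : Type*} {W V : Finset Γ} {x z : Γ → A} (h : AgreeOn W x z) (hV : V ⊆ W) :
    AgreeOn V x z := fun w hw => h w (hV hw)

variable {Γ : Type} [Group Γ] {A : Type*}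

lemma shiftAct_shiftAct (g h : Γ) (x : Γ → A) : shiftAct g (shiftAct h x) = shiftAct (g * h) x := by
  funext δ
  simp only [shiftAct, mul_assoc]

lemma shiftAct_one (x : Γ → A) : shiftAct (1 : Γ) x = x := by
  funext δ
  simp only [shiftAct, mul_one]

lemma shiftAct_conj_iff (σ γ : Γ) (x : Γ → A) :
    shiftAct (σ * γ * σ⁻¹) (shiftAct σ x) = shiftAct σ x ↔ shiftAct γ x = x := by
  rw [shiftAct_shiftAct, inv_mul_cancel_right]
  constructor
  · intro h
    have := congrArg (shiftAct σ⁻¹) h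
    rwa [shiftAct_shiftAct, shiftAct_shiftAct, inv_mul_cancel, inv_mul_cancel_left,
      shiftAct_one] at this
  · intro h
    rw [← shiftAct_shiftAct, h]

lemma shiftAct_mem_freePart {x : Γ → A} (hx : x ∈ freePart Γ A) (σ : Γ) :
    shiftAct σ x ∈ freePart Γ A := by
  intro γ hγ
  have h : shiftAct (σ⁻¹ * γ * σ) x = x := by
    rw [← shiftAct_conj_iff σ]
    rwa [show σ * (σ⁻¹ * γ * σ) * σ⁻¹ = γ by group]
  have h1 := hx _ h
  rw [show γ = σ * (σ⁻¹ * γ * σ) * σ⁻¹ by group, h1]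
  group

lemma mem_mapStab_of_conj {B : Type*} {π : (Γ → A) → (Γ → B)}
    (hπ : EquivariantOn π (freePart Γ A)) {σ γ : Γ}
    (h : σ * γ * σ⁻¹ ∈ mapStab π (freePart Γ A)) : γ ∈ mapStab π (freePart Γ A) := by
  intro x hx
  have := h _ (shiftAct_mem_freePart hx σ)
  rwa [hπ x hx, shiftAct_conj_iff] at this

/-- The point of the shift recording the values of `c` along the orbit of `x`. -/
def orbitMap {X : Type*} [MulAction Γ X] (c : X → A) (x : X) : Γ → A := fun δ => c (δ • x)

lemma orbitMap_smul {X : Type*} [MulAction Γ X] (c : X → A) (γ : Γ) (x : X) :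
    orbitMap c (γ • x) = shiftAct γ (orbitMap c x) := by
  funext δ
  simp only [orbitMap, shiftAct, mul_smul]

lemma isClosed_agreeOn [TopologicalSpace A] [DiscreteTopology A] (W : Finset Γ) (z : Γ → A)
    (g : Γ) : IsClosed {x : Γ → A | AgreeOn W (shiftAct g x) z} := by
  simp only [AgreeOn, shiftAct, Set.ofPred_forall]
  refine isClosed_iInter fun w => isClosed_iInter fun _ => ?_
  have hc : Continuous fun x : Γ → A => x (w * g) := continuous_apply _
  exact (isClosed_discrete ({z w} : Set A)).preimage hc

lemma exists_window {Γ : Type} {k m : ℕ} {π : (Γ → Fin k) → (Γ → Fin m)} {Y : Set (Γ → Fin k)}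
    (hπ : ContinuousOn π Y) {z : Γ → Fin k} (hz : z ∈ Y) (g : Γ) :
    ∃ W : Finset Γ, ∀ x ∈ Y, AgreeOn W x z → π x g = π z g := by
  have h1 : {x | π x g = π z g} ∈ nhdsWithin z Y := by
    have hc : Continuous fun y : Γ → Fin m => y g := continuous_apply g
    have h2 : {y : Γ → Fin m | y g = π z g} ∈ nhds (π z) :=
      ((isOpen_discrete ({π z g} : Set (Fin m))).preimage hc).mem_nhds rfl
    exact hπ z hz h2
  obtain ⟨O, hO, hzO, hOY⟩ := mem_nhdsWithin.1 h1
  obtain ⟨I, u, hu, hsub⟩ := isOpen_pi_iff.1 hO z hzO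
  refine ⟨I, fun x hx hxz => hOY ⟨hsub fun i hi => ?_, hx⟩⟩
  rw [hxz i hi]
  exact (hu i hi).2

lemma freePart_nonempty [Countable Γ] [Infinite Γ] {k : ℕ} (hk : 2 ≤ k) :
    (freePart Γ (Fin k)).Nonempty := by
  classical
  let _ : MeasurableSpace Γ := ⊤
  have _ : DiscreteMeasurableSpace Γ := ⟨fun _ => trivial⟩
  obtain ⟨U, D, h⟩ := exists_realization (Γ := Γ) (A := Fin k) {1} ∅ ⟨1, by simp⟩
    (fun _ => ⟨0, by omega⟩) (fun _ => ⟨1, by omega⟩) (fun _ => ⟨0, by omega⟩)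
  obtain ⟨c, -, hc⟩ := h Γ fun γ x hγ => by simpa using hγ
  refine ⟨c, fun γ hγ => by_contra fun hne => ?_⟩
  obtain ⟨σ, -, h1, h2⟩ := hc.linked γ (by
    rintro ⟨-, g, hg⟩
    simp only [Finset.inv_singleton, inv_one, Finset.singleton_mul_singleton, mul_one,
      Finset.mem_singleton] at hg
    exact hne (conj_eq_one_iff.1 hg)) 1
  have h3 := h1 1 (by simp)
  have h4 := h2 1 (by simp)
  have h5 := congrFun hγ σ
  simp only [shiftAct, smul_eq_mul, one_mul, mul_one] at h3 h4 h5
  rw [h5, h3] at h4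
  simp at h4

end Shift

section Image

open scoped Classical

variable {Γ : Type} [Group Γ]

/-- The set of points in which the patterns `p`, `q` link every non-exceptional element, and in
which each `θ ∈ T` is moved by a translate agreeing with the pattern assigned to a conjugate of
`θ`. -/
def patternShift {A : Type*} (W V : Finset Γ) (T : Set Γ) (D : Γ → Finset Γ) (D' : Finset Γ)
    (p q : Γ → A) (z : Γ → Γ → A) : Set (Γ → A) :=
  {x | (∀ γ, γ ∉ exceptional (W⁻¹ * W) → ∀ δ, ∃ σ ∈ D γ, AgreeOn W (shiftAct (σ * δ) x) p ∧
      AgreeOn W (shiftAct (σ * γ * δ) x) q) ∧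
    ∀ θ ∈ T, ∀ δ, ∃ σ ∈ D', AgreeOn V (shiftAct (σ * δ) x) (z (σ * θ * σ⁻¹))}

lemma isClosed_patternShift {A : Type*} [TopologicalSpace A] [DiscreteTopology A]
    (W V : Finset Γ) (T : Set Γ) (D : Γ → Finset Γ) (D' : Finset Γ) (p q : Γ → A)
    (z : Γ → Γ → A) : IsClosed (patternShift W V T D D' p q z) := by
  have h : patternShift W V T D D' p q z =
      (⋂ γ, ⋂ (_ : γ ∉ exceptional (W⁻¹ * W)), ⋂ δ, ⋃ σ ∈ D γ,
        {x | AgreeOn W (shiftAct (σ * δ) x) p} ∩ {x | AgreeOn W (shiftAct (σ * γ * δ) x) q}) ∩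
      ⋂ θ ∈ T, ⋂ δ, ⋃ σ ∈ D', {x | AgreeOn V (shiftAct (σ * δ) x) (z (σ * θ * σ⁻¹))} := by
    ext x
    simp only [patternShift, Set.mem_ofPred_eq, Set.mem_inter_iff, Set.mem_iInter, Set.mem_iUnion,
      exists_prop]
  rw [h]
  refine (isClosed_iInter fun γ => isClosed_iInter fun _ => isClosed_iInter fun δ =>
    isClosed_biUnion_finset fun σ _ => ?_).inter
    (isClosed_iInter fun θ => isClosed_iInter fun _ => isClosed_iInter fun δ =>
      isClosed_biUnion_finset fun σ _ => isClosed_agreeOn _ _ _)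
  exact (isClosed_agreeOn _ _ _).inter (isClosed_agreeOn _ _ _)

lemma shiftAct_mem_patternShift {A : Type*} {W V : Finset Γ} {T : Set Γ} {D : Γ → Finset Γ}
    {D' : Finset Γ} {p q : Γ → A} {z : Γ → Γ → A} {x : Γ → A}
    (hx : x ∈ patternShift W V T D D' p q z) (g : Γ) :
    shiftAct g x ∈ patternShift W V T D D' p q z := by
  refine ⟨fun γ hγ δ => ?_, fun θ hθ δ => ?_⟩
  · obtain ⟨σ, hσ, h1, h2⟩ := hx.1 γ hγ (δ * g)
    exact ⟨σ, hσ, by rwa [shiftAct_shiftAct, mul_assoc], by rwa [shiftAct_shiftAct, mul_assoc]⟩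
  · obtain ⟨σ, hσ, h1⟩ := hx.2 θ hθ (δ * g)
    exact ⟨σ, hσ, by rwa [shiftAct_shiftAct, mul_assoc]⟩

/-- Finitely many patterns on a common window can be placed disjointly. -/
lemma exists_joint_pattern [Infinite Γ] {A : Type*} [Inhabited A] (V T : Finset Γ)
    (z : Γ → Γ → A) :
    ∃ (e : Γ → Γ) (r : Γ → A), ∀ θ ∈ T, ∀ v ∈ V, r (v * e θ) = z (e θ * θ * (e θ)⁻¹) v := by
  obtain ⟨I, hI, hVI, -⟩ := exists_spread {1} V T.card
  rw [← hI, Finset.card_mul_iff] at hVI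
  let φ : T ≃ I := Finset.equivOfCardEq hI.symm
  let e : Γ → Γ := fun θ => if h : θ ∈ T then φ ⟨θ, h⟩ else 1
  have heI : ∀ θ ∈ T, e θ ∈ I := fun θ hθ => by simp only [e, hθ, dif_pos]; exact (φ _).2
  have heinj : ∀ θ ∈ T, ∀ θ' ∈ T, e θ = e θ' → θ = θ' := by
    intro θ hθ θ' hθ' h
    simp only [e, hθ, hθ', dif_pos] at h
    simpa using φ.injective (Subtype.ext h)
  have hinj : Set.InjOn (fun x : Γ × Γ => x.1 * e x.2) ((V : Set Γ) ×ˢ (T : Set Γ)) := by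
    rintro ⟨v, θ⟩ ⟨hv, hθ⟩ ⟨v', θ'⟩ ⟨hv', hθ'⟩ h
    have := @hVI (v, e θ) ⟨hv, heI θ hθ⟩ (v', e θ') ⟨hv', heI θ' hθ'⟩ h
    simp only [Prod.mk.injEq] at this ⊢
    exact ⟨this.1, heinj θ hθ θ' hθ' this.2⟩
  refine ⟨e, fun g => (fun x : Γ × Γ => z (e x.2 * x.2 * (e x.2)⁻¹) x.1)
    (Function.invFunOn (fun x : Γ × Γ => x.1 * e x.2) ((V : Set Γ) ×ˢ (T : Set Γ)) g), ?_⟩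
  intro θ hθ v hv
  have := hinj.leftInvOn_invFunOn (x := (v, θ)) ⟨hv, hθ⟩
  simp only at this ⊢
  rw [this]

lemma exists_orbitMap_mem_patternShift [Countable Γ] [Infinite Γ] {A : Type} [Inhabited A]
    [MeasurableSpace A] (W V T : Finset Γ) (hW : W.Nonempty)
    (hT : ∀ θ ∈ T, ∀ g, g * θ * g⁻¹ ∈ T) (p q : Γ → A) (z : Γ → Γ → A) :
    ∃ (D : Γ → Finset Γ) (D' : Finset Γ),
      ∀ (X : Type) [MulAction Γ X] [MeasurableSpace X] [MeasurableSpace.CountablySeparated X]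
        [MeasurableConstSMul Γ X], (∀ (γ : Γ) (x : X), γ • x = x → γ = 1) →
        ∃ c : X → A, Measurable c ∧ ∀ x, orbitMap c x ∈ patternShift W V T D D' p q z := by
  obtain ⟨e, r, hr⟩ := exists_joint_pattern V T z
  obtain ⟨U, D, h⟩ := exists_realization W (V * T.image e) hW p q r
  refine ⟨D, T.image e * U, ?_⟩
  intro X _ _ _ _ hfree
  obtain ⟨c, hc, hcr⟩ := h X hfree
  refine ⟨c, hc, fun x => ⟨fun γ hγ δ => ?_, fun θ hθ δ => ?_⟩⟩
  · obtain ⟨σ, hσ, h1, h2⟩ := hcr.linked γ hγ (δ • x)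
    refine ⟨σ, hσ, fun w hw => ?_, fun w hw => ?_⟩
    · rw [← h1 w hw]
      simp only [shiftAct, orbitMap, mul_smul]
    · rw [← h2 w hw]
      simp only [shiftAct, orbitMap, mul_smul]
  · obtain ⟨u, hu, h1⟩ := hcr.syndetic (δ • x)
    have hθ' := hT θ hθ u
    refine ⟨e (u * θ * u⁻¹) * u, Finset.mul_mem_mul (Finset.mem_image_of_mem e hθ') hu, ?_⟩
    intro v hv
    have h2 := h1 _ (Finset.mul_mem_mul hv (Finset.mem_image_of_mem e hθ'))
    rw [hr _ hθ' v hv] at h2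
    simp only [shiftAct, orbitMap, mul_smul] at h2 ⊢
    rw [h2]
    congr 1
    group

end Image

section Main

open scoped Classical

variable {Γ : Type} [Group Γ] {k m : ℕ} {π : (Γ → Fin k) → (Γ → Fin m)}

lemma exists_moving_window (hπ : ContinuousOn π (freePart Γ (Fin k)))
    (hne : (freePart Γ (Fin k)).Nonempty) {θ : Γ} (hθ : θ ≠ 1) :
    ∃ (z : Γ → Fin k) (V : Finset Γ), (∀ x, AgreeOn V x z → shiftAct θ x ≠ x) ∧
      (θ ∉ mapStab π (freePart Γ (Fin k)) →
        ∀ x ∈ freePart Γ (Fin k), AgreeOn V x z → shiftAct θ (π x) ≠ π x) := by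
  have hmove : ∀ z ∈ freePart Γ (Fin k),
      ∃ V : Finset Γ, ∀ x, AgreeOn V x z → shiftAct θ x ≠ x := by
    intro z hz
    obtain ⟨δ, hδ⟩ := Function.ne_iff.1 (mt (hz θ) hθ)
    refine ⟨{δ * θ, δ}, fun x hx h => hδ ?_⟩
    have h1 := congrFun h δ
    simp only [shiftAct] at h1 ⊢
    rw [← hx (δ * θ) (by simp), ← hx δ (by simp), h1]
  by_cases hN : θ ∈ mapStab π (freePart Γ (Fin k))
  · obtain ⟨z, hz⟩ := hne
    obtain ⟨V, hV⟩ := hmove z hz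
    exact ⟨z, V, hV, fun h => (h hN).elim⟩
  · obtain ⟨z, hz, h⟩ : ∃ z ∈ freePart Γ (Fin k), shiftAct θ (π z) ≠ π z := by
      by_contra! h
      exact hN h
    obtain ⟨V, hV⟩ := hmove z hz
    obtain ⟨δ, hδ⟩ := Function.ne_iff.1 h
    obtain ⟨V₁, hV₁⟩ := exists_window hπ hz (δ * θ)
    obtain ⟨V₂, hV₂⟩ := exists_window hπ hz δ
    refine ⟨z, V ∪ V₁ ∪ V₂, fun x hx => hV x (hx.mono (by grind)), fun _ x hx hxz hfix => hδ ?_⟩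
    have h1 := congrFun hfix δ
    simp only [shiftAct] at h1 ⊢
    rw [← hV₁ x hx (hxz.mono (by grind)), ← hV₂ x hx (hxz.mono (by grind)), h1]

/-- If `π` is not constantly a fixed point, then some closed shift-invariant set of free points
maps to points of minimal stabilizer and receives a map from every free action. -/
lemma exists_closed_freePart [Countable Γ] [Infinite Γ] (hk : 2 ≤ k)
    (hπcont : ContinuousOn π (freePart Γ (Fin k)))
    (hπequiv : EquivariantOn π (freePart Γ (Fin k)))
    (hN : mapStab π (freePart Γ (Fin k)) ≠ Set.univ) :
    ∃ Z ⊆ freePart Γ (Fin k), IsSubshift Z ∧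
      (∀ x ∈ Z, ptStab (π x) ⊆ mapStab π (freePart Γ (Fin k))) ∧
      ∀ (X : Type) [MulAction Γ X] [MeasurableSpace X] [MeasurableSpace.CountablySeparated X]
        [MeasurableConstSMul Γ X], (∀ (γ : Γ) (x : X), γ • x = x → γ = 1) →
        ∃ c : X → Fin k, Measurable c ∧ ∀ x, orbitMap c x ∈ Z := by
  have _ : Inhabited (Fin k) := ⟨⟨0, by omega⟩⟩
  have hne : (freePart Γ (Fin k)).Nonempty := freePart_nonempty hk
  obtain ⟨p, q, hp, hq, hpq⟩ : ∃ p q, p ∈ freePart Γ (Fin k) ∧ q ∈ freePart Γ (Fin k) ∧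
      π p 1 ≠ π q 1 := by
    obtain ⟨γ, hγ⟩ := (Set.ne_univ_iff_exists_notMem _).1 hN
    obtain ⟨z, hz, h⟩ : ∃ z ∈ freePart Γ (Fin k), shiftAct γ (π z) ≠ π z := by
      by_contra! h
      exact hγ h
    obtain ⟨δ, hδ⟩ := Function.ne_iff.1 h
    refine ⟨shiftAct (δ * γ) z, shiftAct δ z, shiftAct_mem_freePart hz _,
      shiftAct_mem_freePart hz _, ?_⟩
    rw [hπequiv z hz, hπequiv z hz]
    simpa only [shiftAct, one_mul] using hδ
  obtain ⟨Wp, hWp⟩ := exists_window hπcont hp 1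
  obtain ⟨Wq, hWq⟩ := exists_window hπcont hq 1
  obtain ⟨W, hW1, hWpW, hWqW⟩ : ∃ W : Finset Γ, 1 ∈ W ∧ Wp ⊆ W ∧ Wq ⊆ W :=
    ⟨insert 1 (Wp ∪ Wq), by grind, by grind, by grind⟩
  obtain ⟨T, hT⟩ : ∃ T : Finset Γ, ∀ θ, θ ∈ T ↔ θ ∈ exceptional (W⁻¹ * W) ∧ θ ≠ 1 :=
    ⟨(exceptional_finite (W⁻¹ * W)).toFinset.erase 1, fun θ => by simp [and_comm]⟩
  have hTconj : ∀ θ ∈ T, ∀ g, g * θ * g⁻¹ ∈ T := by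
    intro θ hθ g
    rw [hT] at hθ ⊢
    exact ⟨exceptional_conj hθ.1 g, mt conj_eq_one_iff.1 hθ.2⟩
  have hmov : ∀ θ : Γ, ∃ (z : Γ → Fin k) (V : Finset Γ), θ ≠ 1 →
      (∀ x, AgreeOn V x z → shiftAct θ x ≠ x) ∧
      (θ ∉ mapStab π (freePart Γ (Fin k)) →
        ∀ x ∈ freePart Γ (Fin k), AgreeOn V x z → shiftAct θ (π x) ≠ π x) := by
    intro θ
    by_cases hθ : θ = 1
    · exact ⟨p, ∅, fun h => (h hθ).elim⟩
    · obtain ⟨z, V, h⟩ := exists_moving_window hπcont hne hθ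
      exact ⟨z, V, fun _ => h⟩
  choose z V hzV using hmov
  obtain ⟨D, D', hD⟩ := exists_orbitMap_mem_patternShift W (T.biUnion V) T ⟨1, hW1⟩ hTconj p q z
  have hexc : ∀ x ∈ patternShift W (T.biUnion V) T D D' p q z, ∀ θ ∈ T,
      ∃ σ, σ * θ * σ⁻¹ ≠ 1 ∧ AgreeOn (V (σ * θ * σ⁻¹)) (shiftAct σ x) (z (σ * θ * σ⁻¹)) := by
    intro x hx θ hθ
    obtain ⟨σ, -, hσ⟩ := hx.2 θ hθ 1
    have hσT := hTconj θ hθ σ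
    refine ⟨σ, ((hT _).1 hσT).2, ?_⟩
    rw [mul_one] at hσ
    exact hσ.mono (Finset.subset_biUnion_of_mem V hσT)
  have hlink : ∀ x ∈ patternShift W (T.biUnion V) T D D' p q z,
      ∀ γ, γ ∉ exceptional (W⁻¹ * W) → ∃ σ, AgreeOn W (shiftAct σ x) p ∧
        AgreeOn W (shiftAct (σ * γ) x) q := by
    intro x hx γ hγ
    obtain ⟨σ, -, h1, h2⟩ := hx.1 γ hγ 1
    rw [mul_one] at h1 h2
    exact ⟨σ, h1, h2⟩
  have hZfree : patternShift W (T.biUnion V) T D D' p q z ⊆ freePart Γ (Fin k) := by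
    intro x hx γ hγ
    by_contra hγ1
    by_cases hγe : γ ∈ exceptional (W⁻¹ * W)
    · obtain ⟨σ, hσ1, hσ⟩ := hexc x hx γ ((hT γ).2 ⟨hγe, hγ1⟩)
      exact (hzV _ hσ1).1 _ hσ ((shiftAct_conj_iff σ γ x).2 hγ)
    · obtain ⟨σ, h1, h2⟩ := hlink x hx γ hγe
      rw [← shiftAct_shiftAct, hγ] at h2
      exact hpq (hWp q hq fun w hw => by rw [← h1 w (hWpW hw), h2 w (hWpW hw)]).symm
  refine ⟨_, hZfree, ⟨isClosed_patternShift W _ T D D' p q z,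
    fun γ x hx => shiftAct_mem_patternShift hx γ⟩, ?_, hD⟩
  intro x hx γ hγ
  have hxf := hZfree hx
  by_contra hγN
  have hγ1 : γ ≠ 1 := by
    rintro rfl
    exact hγN fun y _ => shiftAct_one _
  by_cases hγe : γ ∈ exceptional (W⁻¹ * W)
  · obtain ⟨σ, hσ1, hσ⟩ := hexc x hx γ ((hT γ).2 ⟨hγe, hγ1⟩)
    refine (hzV _ hσ1).2 (fun h => hγN (mem_mapStab_of_conj hπequiv h)) _
      (shiftAct_mem_freePart hxf σ) hσ ?_
    rw [hπequiv x hxf]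
    exact (shiftAct_conj_iff σ γ _).2 hγ
  · obtain ⟨σ, h1, h2⟩ := hlink x hx γ hγe
    have e1 := hWp _ (shiftAct_mem_freePart hxf σ) (h1.mono hWpW)
    have e2 := hWq _ (shiftAct_mem_freePart hxf (σ * γ)) (h2.mono hWqW)
    rw [hπequiv x hxf] at e1 e2
    rw [← shiftAct_shiftAct, show shiftAct γ (π x) = π x from hγ] at e2
    exact hpq (e1.symm.trans e2)

lemma measurable_comp_orbitMap [Countable Γ] {Z : Set (Γ → Fin k)} (hπ : ContinuousOn π Z)
    {X : Type} [MulAction Γ X] [MeasurableSpace X] [MeasurableConstSMul Γ X] {c : X → Fin k}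
    (hc : Measurable c) (hZ : ∀ x, orbitMap c x ∈ Z) : Measurable fun x => π (orbitMap c x) := by
  have h1 : Measurable (Z.domRestrict π) := (continuousOn_iff_continuous_domRestrict.1 hπ).measurable
  have h2 : Measurable (orbitMap c : X → Γ → Fin k) :=
    measurable_pi_lambda _ fun δ => hc.comp (measurable_const_smul δ)
  exact h1.comp (h2.subtype_mk (h := hZ))

end Main

/-- Theorem `main`.  Let `Γ` be a countably infinite group, `k ≥ 2`,
`S ⊆ m^Γ` (for some `m ≥ 1`) a subshift of finite type, and `π : Free(k^Γ) → S` a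
continuous `Γ`-equivariant map.  Then there is a subshift `S' ⊆ S` such that the
stabilizer of every point of `S'` equals `Stab(π)`, and every free Borel action of `Γ`
on a Polish space admits a Borel `Γ`-equivariant map to `S'`. -/
theorem stmt0 {Γ : Type} [Group Γ] [Countable Γ] [Infinite Γ]
    (k m : ℕ) (hk : 2 ≤ k) (hm : 1 ≤ m)
    (S : Set (Γ → Fin m)) (hSFT : IsSFT S)
    (π : (Γ → Fin k) → (Γ → Fin m))
    (hπcont : ContinuousOn π (freePart Γ (Fin k)))
    (hπequiv : EquivariantOn π (freePart Γ (Fin k)))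
    (hπmem : ∀ x ∈ freePart Γ (Fin k), π x ∈ S) :
    ∃ S' : Set (Γ → Fin m), S' ⊆ S ∧ IsSubshift S' ∧
      (∀ y ∈ S', ptStab y = mapStab π (freePart Γ (Fin k))) ∧
      (∀ (X : Type) [TopologicalSpace X] [PolishSpace X] [MeasurableSpace X] [BorelSpace X]
        (a : Γ → X → X),
        (∀ x, a 1 x = x) →
        (∀ γ δ : Γ, ∀ x, a (γ * δ) x = a γ (a δ x)) →
        (∀ γ : Γ, Measurable (a γ)) →
        (∀ (γ : Γ) (x : X), a γ x = x → γ = 1) →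
        ∃ f : X → (Γ → Fin m), Measurable f ∧ (∀ x, f x ∈ S') ∧
          ∀ (γ : Γ) (x : X), f (a γ x) = shiftAct γ (f x)) := by
  by_cases hN : mapStab π (freePart Γ (Fin k)) = Set.univ
  · obtain ⟨z, hz⟩ := freePart_nonempty (Γ := Γ) hk
    have hfix : ∀ γ, shiftAct γ (π z) = π z := fun γ =>
      (hN ▸ Set.mem_univ γ : γ ∈ mapStab π (freePart Γ (Fin k))) z hz
    refine ⟨{π z}, by simpa using hπmem z hz, ⟨isClosed_singleton, ?_⟩, ?_, ?_⟩
    · rintro γ x rfl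
      exact hfix γ
    · rintro y rfl
      rw [hN]
      exact Set.eq_univ_of_forall hfix
    · intro X _ _ _ _ a _ _ _ _
      exact ⟨fun _ => π z, measurable_const, fun _ => rfl, fun γ _ => (hfix γ).symm⟩
  · obtain ⟨Z, hZfree, hZ, hstab, hZmap⟩ := exists_closed_freePart hk hπcont hπequiv hN
    refine ⟨π '' Z, ?_, ⟨?_, ?_⟩, ?_, ?_⟩
    · rintro _ ⟨x, hx, rfl⟩
      exact hπmem x (hZfree hx)
    · exact (hZ.1.isCompact.image_of_continuousOn (hπcont.mono hZfree)).isClosed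
    · rintro γ _ ⟨x, hx, rfl⟩
      exact ⟨shiftAct γ x, hZ.2 γ x hx, hπequiv x (hZfree hx) γ⟩
    · rintro _ ⟨x, hx, rfl⟩
      exact (hstab x hx).antisymm fun γ hγ => hγ x (hZfree hx)
    · intro X _ _ _ _ a ha1 hamul hameas hafree
      let _ : MulAction Γ X :=
        { smul := a
          one_smul := ha1
          mul_smul := hamul }
      have _ : MeasurableConstSMul Γ X := ⟨hameas⟩
      obtain ⟨c, hc, hcZ⟩ := hZmap X hafree
      refine ⟨fun x => π (orbitMap c x), measurable_comp_orbitMap (hπcont.mono hZfree) hc hcZ,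
        fun x => ⟨_, hcZ x, rfl⟩, fun γ x => ?_⟩
      rw [← hπequiv _ (hZfree (hcZ x)), ← orbitMap_smul]
      rfl
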